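/- arXiv:1501.03878 — 2 statements merged into one kernel-verified Lean document; each statement's English description precedes it below -/
import Mathlib

section
/- Let N be an integer with 4 ≤ N ≤ 10 and κ̃ := log((N−3)/(N−2)) − 2 log 2. For α ∈ ℝ let x̃(·,α) ∈ C²((−∞,α/2]) denote the solution of x̃'' − (N−3) tanh(s − α/2) x̃' + 2(N−3)(e^{x̃} − 1) = 0 on (−∞,α/2) with x̃(s,α) − 2s + κ̃ → 0 and e^{−s}(x̃'(s,α) − 2) → 0 as s → −∞, and set ỹ(s,α) := x̃'(s,α). Then there exists a strictly increasing sequence α₁ < α₂ < ⋯ → ∞ such that for each j ≥ 1: ỹ(α_j/2, α_j) = 0, the set {s ≤ α_j/2 : ỹ(s,α_j) = 0} is finite, and its cardinality is strictly increasing in j and tends to ∞ as j → ∞. -/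
open Real Set Filter

/-- An orbit of the phase-plane system, in the time variable `t = s - α / 2`, which is asymptotic
to the line `2 * t + c` in the past. -/
structure IsOrbit (M c : ℝ) (x y : ℝ → ℝ) : Prop where
  continuousOn_fst : ContinuousOn x (Iic 0)
  continuousOn_snd : ContinuousOn y (Iic 0)
  hasDerivAt_fst : ∀ t < 0, HasDerivAt x (y t) t
  hasDerivAt_snd : ∀ t < 0, HasDerivAt y (M * tanh t * y t - 2 * M * (exp (x t) - 1)) t
  tendsto_fst : Tendsto (fun t => x t - 2 * t) atBot (nhds c)
  tendsto_snd : Tendsto (fun t => exp (-t) * (y t - 2)) atBot (nhds 0)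

theorem le_of_hasDerivAt_nonpos_of_tendsto_atBot {f f' : ℝ → ℝ} {l : ℝ}
    (hc : ContinuousOn f (Iic 0)) (hd : ∀ t < 0, HasDerivAt f (f' t) t)
    (hn : ∀ t < 0, f' t ≤ 0) (hl : Tendsto f atBot (nhds l)) {t : ℝ} (ht : t ≤ 0) : f t ≤ l := by
  have hanti : AntitoneOn f (Iic 0) := by
    refine antitoneOn_of_hasDerivWithinAt_nonpos (f' := f') (convex_Iic 0) hc ?_ ?_
    · intro s hs
      rw [interior_Iic] at hs ⊢
      exact (hd s hs).hasDerivWithinAt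
    · intro s hs
      rw [interior_Iic] at hs
      exact hn s hs
  refine ge_of_tendsto hl ?_
  filter_upwards [eventually_le_atBot t] with s hs
  exact hanti (hs.trans ht) ht hs

theorem tanh_nonpos_of_nonpos {t : ℝ} (ht : t ≤ 0) : tanh t ≤ 0 := by
  rw [tanh_eq_sinh_div_cosh]
  exact div_nonpos_of_nonpos_of_nonneg (sinh_nonpos_iff.2 ht) (cosh_pos t).le

theorem one_add_tanh_nonneg (t : ℝ) : 0 ≤ 1 + tanh t := by
  rw [tanh_eq_sinh_div_cosh, one_add_div (cosh_pos t).ne', add_comm, sinh_add_cosh]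
  exact div_nonneg (exp_pos t).le (cosh_pos t).le

theorem one_add_tanh_le (t : ℝ) : 1 + tanh t ≤ 2 * exp (2 * t) := by
  rw [tanh_eq_sinh_div_cosh, one_add_div (cosh_pos t).ne', add_comm (cosh t), sinh_add_cosh,
    div_le_iff₀ (cosh_pos t), cosh_eq]
  have h1 : exp (2 * t) * exp (-t) = exp t := by rw [← exp_add]; ring_nf
  have := mul_pos (exp_pos (2 * t)) (exp_pos t)
  nlinarith

theorem hasDerivAt_exp_two_mul (t : ℝ) : HasDerivAt (fun s => exp (2 * s)) (2 * exp (2 * t)) t := by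
  have := ((hasDerivAt_id t).const_mul 2).exp
  simpa [mul_comm] using this

theorem tendsto_exp_two_mul_atBot : Tendsto (fun t : ℝ => exp (2 * t)) atBot (nhds 0) :=
  tendsto_exp_atBot.comp (tendsto_id.const_mul_atBot two_pos)

/-- The integrating factor is `(cosh t) ^ (-M)`. -/
theorem nonpos_of_hasDerivAt_le_tanh_mul {M : ℝ} (hM : 0 ≤ M) {f f' : ℝ → ℝ}
    (hc : ContinuousOn f (Iic 0)) (hd : ∀ t < 0, HasDerivAt f (f' t) t)
    (hn : ∀ t < 0, f' t ≤ M * tanh t * f t) (hl : Tendsto f atBot (nhds 0)) {t : ℝ} (ht : t ≤ 0) :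
    f t ≤ 0 := by
  set W : ℝ → ℝ := fun t => exp (-M * log (cosh t)) with hW
  have hWpos : ∀ t, 0 < W t := fun t => exp_pos _
  have hWd : ∀ t, HasDerivAt W (W t * (-M * tanh t)) t := by
    intro t
    have := (((hasDerivAt_cosh t).log (cosh_pos t).ne').const_mul (-M)).exp
    rwa [← tanh_eq_sinh_div_cosh] at this
  have hW1 : ∀ t, W t ≤ 1 := by
    intro t
    have := mul_nonneg hM (log_nonneg (one_le_cosh t))
    exact exp_le_one_iff.2 (by linarith)
  have key : f t * W t ≤ 0 := by
    refine le_of_hasDerivAt_nonpos_of_tendsto_atBot (f := fun t => f t * W t)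
      (f' := fun t => f' t * W t + f t * (W t * (-M * tanh t)))
      (hc.mul fun s _ => (hWd s).continuousAt.continuousWithinAt)
      (fun s hs => (hd s hs).mul (hWd s)) (fun s hs => ?_) ?_ ht
    · nlinarith [mul_nonneg (sub_nonneg.2 (hn s hs)) (hWpos s).le]
    · refine squeeze_zero_norm (fun s => ?_) (tendsto_norm_zero.comp hl)
      rw [norm_mul, Function.comp_apply, Real.norm_of_nonneg (hWpos s).le]
      exact mul_le_of_le_one_right (norm_nonneg _) (hW1 s)
  exact nonpos_of_mul_nonpos_left key (hWpos t)

namespace IsOrbit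

variable {M c : ℝ} {x y : ℝ → ℝ}

theorem tendsto_snd_sub_two (h : IsOrbit M c x y) :
    Tendsto (fun t => y t - 2) atBot (nhds 0) := by
  have := tendsto_exp_atBot.mul h.tendsto_snd
  simp only [← mul_assoc, ← exp_add] at this
  simpa using this

theorem snd_le (h : IsOrbit M c x y) (hM : 0 ≤ M) {t : ℝ} (ht : t ≤ 0) :
    y t ≤ 2 + 2 * M * exp (2 * t) := by
  have := nonpos_of_hasDerivAt_le_tanh_mul hM (f := fun t => y t - 2 - 2 * M * exp (2 * t))
    ((h.continuousOn_snd.sub continuousOn_const).sub (by fun_prop))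
    (fun s hs => ((h.hasDerivAt_snd s hs).sub_const 2).sub
      ((hasDerivAt_exp_two_mul s).const_mul (2 * M))) (fun s hs => ?_)
    (by simpa using h.tendsto_snd_sub_two.sub (tendsto_exp_two_mul_atBot.const_mul (2 * M))) ht
  · linarith
  · have h1 := one_add_tanh_le s
    have h2 := mul_nonneg (mul_nonneg hM hM) (mul_nonneg (exp_pos (2 * s)).le
      (neg_nonneg.2 (tanh_nonpos_of_nonpos hs.le)))
    have h3 := mul_nonneg hM (exp_pos (x s)).le
    nlinarith [mul_le_mul_of_nonneg_left h1 hM]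

theorem fst_le (h : IsOrbit M c x y) (hM : 0 ≤ M) {t : ℝ} (ht : t ≤ 0) :
    x t ≤ 2 * t + c + M * exp (2 * t) := by
  have := le_of_hasDerivAt_nonpos_of_tendsto_atBot (l := c)
    (f := fun t => x t - 2 * t - M * exp (2 * t))
    ((h.continuousOn_fst.sub (by fun_prop)).sub (by fun_prop))
    (fun s hs => ((h.hasDerivAt_fst s hs).sub ((hasDerivAt_id s).const_mul 2)).sub
      ((hasDerivAt_exp_two_mul s).const_mul M)) (fun s hs => ?_)
    (by simpa using h.tendsto_fst.sub (tendsto_exp_two_mul_atBot.const_mul M)) ht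
  · linarith
  · linarith [h.snd_le hM hs.le]

theorem exp_fst_le (h : IsOrbit M c x y) (hM : 0 ≤ M) {t : ℝ} (ht : t ≤ 0) :
    exp (x t) ≤ exp (c + M) * exp (2 * t) := by
  rw [← exp_add, exp_le_exp]
  have h1 : exp (2 * t) ≤ 1 := exp_le_one_iff.2 (by linarith)
  nlinarith [h.fst_le hM ht]

theorem le_snd (h : IsOrbit M c x y) (hM : 0 ≤ M) {t : ℝ} (ht : t ≤ 0) :
    2 - M * exp (c + M) * exp (2 * t) ≤ y t := by
  have := nonpos_of_hasDerivAt_le_tanh_mul hM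
    (f := fun t => -(y t - 2) - M * exp (c + M) * exp (2 * t))
    ((h.continuousOn_snd.sub continuousOn_const).neg.sub (by fun_prop))
    (fun s hs => ((h.hasDerivAt_snd s hs).sub_const 2).neg.sub
      ((hasDerivAt_exp_two_mul s).const_mul (M * exp (c + M)))) (fun s hs => ?_)
    (by simpa using h.tendsto_snd_sub_two.neg.sub
          (tendsto_exp_two_mul_atBot.const_mul (M * exp (c + M)))) ht
  · linarith
  · have h1 := one_add_tanh_nonneg s
    have h2 := mul_nonneg (mul_nonneg hM hM) (mul_nonneg (mul_nonneg (exp_pos (c + M)).le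
      (exp_pos (2 * s)).le) (neg_nonneg.2 (tanh_nonpos_of_nonpos hs.le)))
    have h3 := mul_le_mul_of_nonneg_left (h.exp_fst_le hM hs.le) hM
    nlinarith [mul_nonneg hM h1]

theorem le_fst (h : IsOrbit M c x y) (hM : 0 ≤ M) {t : ℝ} (ht : t ≤ 0) :
    2 * t + c - M * exp (c + M) * exp (2 * t) ≤ x t := by
  have := le_of_hasDerivAt_nonpos_of_tendsto_atBot (l := -c)
    (f := fun t => -(x t - 2 * t) - M * exp (c + M) * exp (2 * t))
    ((h.continuousOn_fst.sub (by fun_prop)).neg.sub (by fun_prop))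
    (fun s hs => ((h.hasDerivAt_fst s hs).sub ((hasDerivAt_id s).const_mul 2)).neg.sub
      ((hasDerivAt_exp_two_mul s).const_mul (M * exp (c + M)))) (fun s hs => ?_)
    (by simpa using h.tendsto_fst.neg.sub
          (tendsto_exp_two_mul_atBot.const_mul (M * exp (c + M)))) ht
  · linarith
  · have := mul_nonneg hM (mul_nonneg (exp_pos (c + M)).le (exp_pos (2 * s)).le)
    linarith [h.le_snd hM hs.le]

theorem hasDerivAt_energy (h : IsOrbit M c x y) {t : ℝ} (ht : t < 0) :
    HasDerivAt (fun t => y t ^ 2 / 2 + 2 * M * (exp (x t) - 1 - x t)) (M * tanh t * y t ^ 2) t := by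
  have hx := h.hasDerivAt_fst t ht
  refine ((((h.hasDerivAt_snd t ht).pow 2).div_const 2).add
    (((hx.exp.sub_const 1).sub hx).const_mul (2 * M))).congr_deriv ?_
  norm_num
  ring

theorem continuousOn_energy (h : IsOrbit M c x y) :
    ContinuousOn (fun t => y t ^ 2 / 2 + 2 * M * (exp (x t) - 1 - x t)) (Iic 0) := by
  have hx := h.continuousOn_fst
  have hy := h.continuousOn_snd
  fun_prop

theorem antitoneOn_energy (h : IsOrbit M c x y) (hM : 0 ≤ M) :
    AntitoneOn (fun t => y t ^ 2 / 2 + 2 * M * (exp (x t) - 1 - x t)) (Iic 0) := by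
  refine antitoneOn_of_hasDerivWithinAt_nonpos (convex_Iic 0) h.continuousOn_energy
    (f' := fun t => M * tanh t * y t ^ 2) ?_ ?_ <;> intro s hs <;> rw [interior_Iic] at *
  · exact (h.hasDerivAt_energy hs).hasDerivWithinAt
  · exact mul_nonpos_of_nonpos_of_nonneg
      (mul_nonpos_of_nonneg_of_nonpos hM (tanh_nonpos_of_nonpos (le_of_lt hs))) (sq_nonneg _)

theorem fst_ne_zero (h : IsOrbit M c x y) (hM : 0 ≤ M) {t : ℝ} (ht : t ≤ 0) (hy : y t = 0) :
    x t ≠ 0 := by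
  intro hx
  have hmono : MonotoneOn (fun t => (y t ^ 2 / 2 + 2 * M * (exp (x t) - 1 - x t)) *
      exp (M * (2 * t))) (Iic 0) := by
    refine monotoneOn_of_hasDerivWithinAt_nonneg (convex_Iic 0)
      (h.continuousOn_energy.mul (by fun_prop)) (f' := fun t => M * tanh t * y t ^ 2 *
      exp (M * (2 * t)) + (y t ^ 2 / 2 + 2 * M * (exp (x t) - 1 - x t)) *
      (exp (M * (2 * t)) * (M * (2 * 1)))) ?_ ?_ <;> intro s hs <;> rw [interior_Iic] at *
    · exact ((h.hasDerivAt_energy hs).mul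
        (((hasDerivAt_id s).const_mul 2).const_mul M).exp).hasDerivWithinAt
    · have h1 : 0 ≤ exp (x s) - 1 - x s := by linarith [add_one_le_exp (x s)]
      have h2 := exp_pos (M * (2 * s))
      have h3 : 0 ≤ M * (1 + tanh s) * y s ^ 2 := by
        have := one_add_tanh_nonneg s; positivity
      have h4 : 0 ≤ M * M * (exp (x s) - 1 - x s) := by positivity
      nlinarith [mul_nonneg h3 h2.le, mul_nonneg h4 h2.le]
  have hzero : ∀ s ≤ t, y s = 0 := by
    intro s hs
    have h0 := hmono (hs.trans ht) ht hs
    simp only [hx, hy, exp_zero] at h0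
    norm_num at h0
    have h1 : 0 ≤ exp (x s) - 1 - x s := by linarith [add_one_le_exp (x s)]
    have h2 := nonpos_of_mul_nonpos_left h0 (exp_pos _)
    nlinarith [mul_nonneg hM h1, sq_nonneg (y s)]
  have hlim : Tendsto (fun t => y t - 2) atBot (nhds (0 - 2)) := by
    refine tendsto_const_nhds.congr' ?_
    filter_upwards [eventually_le_atBot t] with s hs
    rw [hzero s hs]
  have := tendsto_nhds_unique hlim h.tendsto_snd_sub_two
  norm_num at this

theorem snd_deriv_ne_zero (h : IsOrbit M c x y) (hM : 0 < M) {t : ℝ} (ht : t ≤ 0) (hy : y t = 0) :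
    M * tanh t * y t - 2 * M * (exp (x t) - 1) ≠ 0 := by
  have := h.fst_ne_zero hM.le ht hy
  simp [hy, hM.ne', sub_eq_zero, this]

end IsOrbit

theorem abs_exp_sub_exp_le {a b C : ℝ} (ha : exp a ≤ C) (hb : exp b ≤ C) :
    |exp a - exp b| ≤ C * |a - b| := by
  wlog hab : b ≤ a generalizing a b
  · rw [abs_sub_comm, abs_sub_comm a]
    exact this hb ha (le_of_not_ge hab)
  rw [abs_of_nonneg (sub_nonneg.2 (exp_le_exp.2 hab)), abs_of_nonneg (sub_nonneg.2 hab)]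
  have h1 := add_one_le_exp (b - a)
  have h2 : exp b = exp a * exp (b - a) := by rw [← exp_add]; ring_nf
  have h3 := exp_pos a
  nlinarith [mul_le_mul_of_nonneg_right ha (sub_nonneg.2 hab)]

/-- Continuous dependence on the asymptotic parameter: a Grönwall estimate started at `-∞`. -/
theorem IsOrbit.dist_le {M c d B : ℝ} {x y u v : ℝ → ℝ} (hM : 0 ≤ M) (h : IsOrbit M c x y)
    (k : IsOrbit M d u v) (hc : c ≤ B) (hd : d ≤ B) {t : ℝ} (ht : t ≤ 0) :
    (x t - u t) ^ 2 + (exp (-t) * (y t - v t)) ^ 2 ≤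
      (c - d) ^ 2 * exp (1 + 2 * M * exp (B + M)) := by
  set L := 1 + 2 * M * exp (B + M) with hL
  have hLpos : 0 < L := by positivity
  have hE : ∀ s, HasDerivAt (fun s => exp (-s)) (-exp (-s)) s := fun s => by
    simpa using (hasDerivAt_neg s).exp
  have hF : ∀ s, HasDerivAt (fun s => exp (-(L * exp s))) (-(L * exp s) * exp (-(L * exp s))) s := by
    intro s
    refine (((hasDerivAt_exp s).const_mul L).neg).exp.congr_deriv ?_
    simp only [Pi.neg_apply]
    ring
  have hxc := h.continuousOn_fst
  have hyc := h.continuousOn_snd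
  have huc := k.continuousOn_fst
  have hvc := k.continuousOn_snd
  have key := le_of_hasDerivAt_nonpos_of_tendsto_atBot (l := (c - d) ^ 2)
    (f := fun t => ((x t - u t) ^ 2 + (exp (-t) * (y t - v t)) ^ 2) * exp (-(L * exp t)))
    (by fun_prop)
    (fun s hs => ((((h.hasDerivAt_fst s hs).sub (k.hasDerivAt_fst s hs)).pow 2).add
      (((hE s).mul ((h.hasDerivAt_snd s hs).sub (k.hasDerivAt_snd s hs))).pow 2)).mul (hF s))
    (fun s hs => ?_) ?_ ht
  · have h1 : exp (-(L * exp t)) * exp L ≥ 1 := by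
      rw [← exp_add]
      refine one_le_exp ?_
      have : exp t ≤ 1 := exp_le_one_iff.2 ht
      nlinarith
    have h2 : 0 ≤ (x t - u t) ^ 2 + (exp (-t) * (y t - v t)) ^ 2 := by positivity
    have h3 := mul_le_mul_of_nonneg_right key (exp_pos L).le
    nlinarith
  · have hexp := exp_pos (-(L * exp s))
    set D := x s - u s with hD
    set r := exp (-s) * (y s - v s) with hr
    have hee : exp s * exp (-s) = 1 := by rw [← exp_add]; simp
    have hyv : y s - v s = exp s * r := by rw [hr, ← mul_assoc, hee, one_mul]
    have hbound : |exp (x s) - exp (u s)| ≤ exp (B + M) * exp (2 * s) * |D| := by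
      refine abs_exp_sub_exp_le ((h.exp_fst_le hM hs.le).trans ?_)
        ((k.exp_fst_le hM hs.le).trans ?_) <;> gcongr
    set q := exp (-s) * (exp (x s) - exp (u s)) with hq
    have hqb : |q| ≤ exp (B + M) * exp s * |D| := by
      rw [hq, abs_mul, abs_of_pos (exp_pos _)]
      calc _ ≤ exp (-s) * (exp (B + M) * exp (2 * s) * |D|) := by gcongr
        _ = exp (B + M) * (exp (-s) * exp (2 * s)) * |D| := by ring
        _ = _ := by rw [← exp_add]; ring_nf
    have hmain : 2 * D * (exp s * r) + 2 * r * (-r + M * tanh s * r - 2 * M * q) ≤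
        L * exp s * (D ^ 2 + r ^ 2) := by
      have h1 : 2 * |D| * |r| ≤ D ^ 2 + r ^ 2 := by
        nlinarith [sq_nonneg (|D| - |r|), sq_abs D, sq_abs r]
      have h2 : D * r ≤ |D| * |r| := by rw [← abs_mul]; exact le_abs_self _
      have h3 : -(r * q) ≤ |r| * (exp (B + M) * exp s * |D|) := by
        calc -(r * q) ≤ |r * q| := neg_le_abs _
          _ = |r| * |q| := abs_mul _ _
          _ ≤ _ := by gcongr
      have h4 : M * tanh s * r ^ 2 ≤ 0 := mul_nonpos_of_nonpos_of_nonneg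
        (mul_nonpos_of_nonneg_of_nonpos hM (tanh_nonpos_of_nonpos hs.le)) (sq_nonneg _)
      have h5 := mul_le_mul_of_nonneg_left h2 (exp_pos s).le
      have h6 := mul_le_mul_of_nonneg_left h3 hM
      have h7 := mul_le_mul_of_nonneg_left h1 (mul_pos hLpos (exp_pos s)).le
      rw [hL] at h7 ⊢
      nlinarith [sq_nonneg r]
    have hz := mul_le_mul_of_nonneg_right hmain hexp.le
    refine le_trans (le_of_eq ?_) (sub_nonpos.2 hz)
    simp only [Pi.sub_apply, Pi.mul_apply, ← hD, ← hr]
    have e1 : exp (-s) * (M * tanh s * y s - 2 * M * (exp (x s) - 1) -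
        (M * tanh s * v s - 2 * M * (exp (u s) - 1))) = M * tanh s * r - 2 * M * q := by
      rw [hr, hq]; ring
    rw [e1, neg_mul, ← hr, hyv]
    norm_num
    ring
  · have h1 := (h.tendsto_fst.sub k.tendsto_fst).pow 2
    have h2 := (h.tendsto_snd.sub k.tendsto_snd).pow 2
    have h3 : Tendsto (fun t => exp (-(L * exp t))) atBot (nhds 1) := by
      simpa using ((tendsto_exp_atBot.const_mul L).neg).rexp
    convert (h1.add h2).mul h3 using 1
    · ext s; ring
    · simp

theorem subsingleton_zeros_of_deriv_ne_zero {f f' : ℝ → ℝ} {s : Set ℝ} (hs : s.OrdConnected)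
    (hd : ∀ t < 0, HasDerivAt f (f' t) t) (hc : ContinuousOn f (Iic 0))
    (hne : ∀ t ∈ s, f' t ≠ 0) : (s ∩ {t | t ≤ 0 ∧ f t = 0}).Subsingleton := by
  have key : ∀ a ∈ s ∩ {t | t ≤ 0 ∧ f t = 0}, ∀ b ∈ s ∩ {t | t ≤ 0 ∧ f t = 0}, ¬ a < b := by
    rintro a ⟨has, ha0, hfa⟩ b ⟨hbs, hb0, hfb⟩ hab
    obtain ⟨z, hz, hz'⟩ := exists_hasDerivAt_eq_zero (f := f) (f' := f') hab
      (hc.mono fun u hu => hu.2.trans hb0) (hfa.trans hfb.symm)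
      (fun u hu => hd u (hu.2.trans_le hb0))
    exact hne z (hs.out has hbs (Ioo_subset_Icc_self hz)) hz'
  intro a ha b hb
  exact le_antisymm (not_lt.1 (key b hb a ha)) (not_lt.1 (key a ha b hb))

theorem exists_nhds_zeros_subsingleton {Y P : ℝ → ℝ → ℝ}
    (hY : Continuous (Function.uncurry Y)) (hP : Continuous (Function.uncurry P))
    (hd : ∀ α, ∀ t < 0, HasDerivAt (Y α) (P α t) t)
    (hne : ∀ α, ∀ t ≤ 0, Y α t = 0 → P α t ≠ 0) (α₀ t₀ : ℝ) (ht₀ : t₀ ≤ 0) :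
    ∃ V ∈ nhds t₀, ∀ᶠ α in nhds α₀, (V ∩ {t | t ≤ 0 ∧ Y α t = 0}).Subsingleton ∧
      (Y α₀ t₀ ≠ 0 → V ∩ {t | t ≤ 0 ∧ Y α t = 0} = ∅) := by
  by_cases h0 : Y α₀ t₀ = 0
  · have h1 : ∀ᶠ p in nhds (α₀, t₀), Function.uncurry P p ≠ 0 :=
      hP.continuousAt.eventually_ne (hne α₀ t₀ ht₀ h0)
    rw [nhds_prod_eq, eventually_prod_iff] at h1
    obtain ⟨p, hp, q, hq, hpq⟩ := h1
    obtain ⟨ε, hε, hball⟩ := Metric.eventually_nhds_iff_ball.1 hq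
    refine ⟨Metric.ball t₀ ε, Metric.ball_mem_nhds _ hε, ?_⟩
    filter_upwards [hp] with α hα
    refine ⟨subsingleton_zeros_of_deriv_ne_zero (convex_ball t₀ ε).ordConnected (hd α)
      (hY.comp (by fun_prop : Continuous fun t => (α, t))).continuousOn
      (fun t ht => hpq hα (hball t ht)), fun h => absurd h0 h⟩
  · have h1 : ∀ᶠ p in nhds (α₀, t₀), Function.uncurry Y p ≠ 0 := hY.continuousAt.eventually_ne h0
    rw [nhds_prod_eq, eventually_prod_iff] at h1
    obtain ⟨p, hp, q, hq, hpq⟩ := h1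
    refine ⟨{t | q t}, hq, ?_⟩
    filter_upwards [hp] with α hα
    have he : {t | q t} ∩ {t | t ≤ 0 ∧ Y α t = 0} = ∅ := by
      ext t
      simp only [mem_inter_iff, mem_ofPred_eq, mem_empty_iff_false, iff_false]
      rintro ⟨ht, -, h⟩
      exact hpq hα ht h
    exact ⟨by rw [he]; exact subsingleton_empty, fun _ => he⟩

theorem eventually_exists_injOn_zeros {Y P : ℝ → ℝ → ℝ}
    (hY : Continuous (Function.uncurry Y)) (hP : Continuous (Function.uncurry P))
    (hd : ∀ α, ∀ t < 0, HasDerivAt (Y α) (P α t) t)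
    (hne : ∀ α, ∀ t ≤ 0, Y α t = 0 → P α t ≠ 0)
    (hT : ∀ α₀, ∃ T, ∀ᶠ α in nhds α₀, ∀ t ≤ T, Y α t ≠ 0) (α₀ : ℝ) :
    ∃ F : Finset ℝ, ∀ᶠ α in nhds α₀, ∃ g : ℝ → ℝ,
      MapsTo g {t | t ≤ 0 ∧ Y α t = 0} ({t | t ≤ 0 ∧ Y α₀ t = 0} ∩ F) ∧
      InjOn g {t | t ≤ 0 ∧ Y α t = 0} := by
  obtain ⟨T, hT⟩ := hT α₀
  have hloc := fun t₀ : ℝ => fun ht : t₀ ∈ Icc T 0 =>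
    exists_nhds_zeros_subsingleton hY hP hd hne α₀ t₀ ht.2
  choose! V hV hVα using hloc
  obtain ⟨F, hF, hcover⟩ := isCompact_Icc.elim_nhds_subcover V hV
  refine ⟨F, ?_⟩
  have hall := (Finset.eventually_all F).2 fun t ht => hVα t (hF t ht)
  filter_upwards [hT, hall] with α h1 h2
  have hex : ∀ t ∈ {t | t ≤ 0 ∧ Y α t = 0}, ∃ u ∈ F, t ∈ V u := by
    rintro t ⟨ht0, ht⟩
    have hmem : t ∈ Icc T 0 := ⟨le_of_not_ge fun h => h1 t h ht, ht0⟩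
    simpa using hcover hmem
  choose! g hgF hgV using hex
  refine ⟨g, fun t ht => ⟨⟨(hF _ (hgF t ht)).2, ?_⟩, hgF t ht⟩, fun a ha b hb hab => ?_⟩
  · by_contra hcon
    have := (h2 _ (hgF t ht)).2 hcon
    exact (this ▸ (⟨hgV t ht, ht⟩ : t ∈ V (g t) ∩ {t | t ≤ 0 ∧ Y α t = 0}) : t ∈ (∅ : Set ℝ))
  · exact (h2 _ (hgF a ha)).1 ⟨hgV a ha, ha⟩ ⟨hab ▸ hgV b hb, hb⟩

theorem finite_zeros {Y P : ℝ → ℝ → ℝ}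
    (hY : Continuous (Function.uncurry Y)) (hP : Continuous (Function.uncurry P))
    (hd : ∀ α, ∀ t < 0, HasDerivAt (Y α) (P α t) t)
    (hne : ∀ α, ∀ t ≤ 0, Y α t = 0 → P α t ≠ 0)
    (hT : ∀ α₀, ∃ T, ∀ᶠ α in nhds α₀, ∀ t ≤ T, Y α t ≠ 0) (α : ℝ) :
    {t | t ≤ 0 ∧ Y α t = 0}.Finite := by
  obtain ⟨F, hF⟩ := eventually_exists_injOn_zeros hY hP hd hne hT α
  obtain ⟨g, hg, hinj⟩ := hF.self_of_nhds
  exact Set.Finite.of_injOn (hg.mono_right inter_subset_right) hinj F.finite_toSet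

theorem eventually_ncard_zeros_le {Y P : ℝ → ℝ → ℝ}
    (hY : Continuous (Function.uncurry Y)) (hP : Continuous (Function.uncurry P))
    (hd : ∀ α, ∀ t < 0, HasDerivAt (Y α) (P α t) t)
    (hne : ∀ α, ∀ t ≤ 0, Y α t = 0 → P α t ≠ 0)
    (hT : ∀ α₀, ∃ T, ∀ᶠ α in nhds α₀, ∀ t ≤ T, Y α t ≠ 0) (α₀ : ℝ) :
    ∀ᶠ α in nhds α₀, {t | t ≤ 0 ∧ Y α t = 0}.ncard ≤ {t | t ≤ 0 ∧ Y α₀ t = 0}.ncard := by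
  obtain ⟨F, hF⟩ := eventually_exists_injOn_zeros hY hP hd hne hT α₀
  filter_upwards [hF] with α ⟨g, hg, hinj⟩
  exact Set.ncard_le_ncard_of_injOn g (fun t ht => (hg ht).1) hinj
    (finite_zeros hY hP hd hne hT α₀)

theorem eventually_ncard_interior_zeros_le {Y P : ℝ → ℝ → ℝ}
    (hY : Continuous (Function.uncurry Y)) (hP : Continuous (Function.uncurry P))
    (hd : ∀ α, ∀ t < 0, HasDerivAt (Y α) (P α t) t)
    (hne : ∀ α, ∀ t ≤ 0, Y α t = 0 → P α t ≠ 0)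
    (hT : ∀ α₀, ∃ T, ∀ᶠ α in nhds α₀, ∀ t ≤ T, Y α t ≠ 0) (α₀ : ℝ) :
    ∀ᶠ α in nhds α₀, {t | t < 0 ∧ Y α₀ t = 0}.ncard ≤ {t | t ≤ 0 ∧ Y α t = 0}.ncard := by
  have hfin : {t | t < 0 ∧ Y α₀ t = 0}.Finite :=
    (finite_zeros hY hP hd hne hT α₀).subset fun t ht => ⟨ht.1.le, ht.2⟩
  obtain ⟨U, hU, hdisj⟩ := hfin.t2_separation
  have hYα : ∀ t, Continuous fun α => Y α t := fun t =>
    hY.comp (by fun_prop : Continuous fun α => (α, t))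
  have hYt : ∀ α, Continuous (Y α) := fun α =>
    hY.comp (by fun_prop : Continuous fun t => (α, t))
  have hloc : ∀ z ∈ {t | t < 0 ∧ Y α₀ t = 0}, ∀ᶠ α in nhds α₀, ∃ t ∈ U z, t ≤ 0 ∧ Y α t = 0 := by
    rintro z ⟨hz0, hz⟩
    have hnhds : ∀ᶠ t in nhds z, t ∈ U z ∩ Iio 0 :=
      ((hU z).2.inter isOpen_Iio).mem_nhds ⟨(hU z).1, hz0⟩
    obtain ⟨ε, hε, hball⟩ := Metric.eventually_nhds_iff_ball.1 hnhds
    have hmem := Metric.ball_mem_nhds z hε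
    have hPz := hne α₀ z hz0.le hz
    obtain ⟨p, hp, hpY⟩ : ∃ p ∈ Metric.ball z ε, Y α₀ p < 0 := by
      by_contra! hcon
      refine hPz (IsLocalMin.hasDerivAt_eq_zero ?_ (hd α₀ z hz0))
      filter_upwards [hmem] with t ht
      rw [hz]; exact hcon t ht
    obtain ⟨q, hq, hqY⟩ : ∃ p ∈ Metric.ball z ε, 0 < Y α₀ p := by
      by_contra! hcon
      refine hPz (IsLocalMax.hasDerivAt_eq_zero ?_ (hd α₀ z hz0))
      filter_upwards [hmem] with t ht
      rw [hz]; exact hcon t ht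
    filter_upwards [(hYα p).continuousAt.eventually_lt_const hpY,
      (hYα q).continuousAt.eventually_const_lt hqY] with α h1 h2
    obtain ⟨t, ht, ht'⟩ := (convex_ball z ε).isPreconnected.intermediate_value hp hq
      (hYt α).continuousOn ⟨h1.le, h2.le⟩
    exact ⟨t, (hball t ht).1, (hball t ht).2.le, ht'⟩
  filter_upwards [(hfin.eventually_all).2 hloc] with α hα
  choose! g hgU hg0 hgY using hα
  refine Set.ncard_le_ncard_of_injOn g (fun z hz => ⟨hg0 z hz, hgY z hz⟩) (fun a ha b hb hab => ?_)
    (finite_zeros hY hP hd hne hT α)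
  by_contra hne'
  exact Set.disjoint_left.1 (hdisj ha hb hne') (hgU a ha) (hab ▸ hgU b hb)

theorem exists_seq_ncard_zeros {Y P : ℝ → ℝ → ℝ}
    (hY : Continuous (Function.uncurry Y)) (hP : Continuous (Function.uncurry P))
    (hd : ∀ α, ∀ t < 0, HasDerivAt (Y α) (P α t) t)
    (hne : ∀ α, ∀ t ≤ 0, Y α t = 0 → P α t ≠ 0)
    (hT : ∀ α₀, ∃ T, ∀ᶠ α in nhds α₀, ∀ t ≤ T, Y α t ≠ 0)
    (hunb : ∀ n : ℕ, ∃ α ≥ 0, n ≤ {t | t ≤ 0 ∧ Y α t = 0}.ncard) :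
    ∃ (a : ℕ → ℝ) (m : ℕ), StrictMono a ∧ Tendsto a atTop atTop ∧ ∀ j, Y (a j) 0 = 0 ∧
      {t | t ≤ 0 ∧ Y (a j) t = 0}.ncard = m + j := by
  set n : ℝ → ℕ := fun α => {t | t ≤ 0 ∧ Y α t = 0}.ncard with hn
  have hU : ∀ α₀, ∀ᶠ α in nhds α₀, n α ≤ n α₀ := eventually_ncard_zeros_le hY hP hd hne hT
  set S : ℕ → Set ℝ := fun k => {α | 0 ≤ α ∧ k ≤ n α} with hS
  have hbdd : ∀ k, BddBelow (S k) := fun k => ⟨0, fun α hα => hα.1⟩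
  have hclosed : ∀ k, IsClosed (S k) := by
    intro k
    suffices hk : IsClosed {α | k ≤ n α} by exact isClosed_Ici.inter hk
    rw [← isOpen_compl_iff, isOpen_iff_eventually]
    intro α hα
    filter_upwards [hU α] with β hβ hk
    exact hα (le_trans hk hβ)
  have hnon : ∀ k, (S k).Nonempty := fun k => hunb k
  have hmem : ∀ k, sInf (S k) ∈ S k := fun k => (hclosed k).csInf_mem (hnon k) (hbdd k)
  have hkey : ∀ k, n 0 < k → Y (sInf (S k)) 0 = 0 ∧ n (sInf (S k)) = k := by
    intro k hk
    set α := sInf (S k) with hα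
    have hα0 : 0 < α := by
      refine lt_of_le_of_ne (hmem k).1 fun h => ?_
      have := (hmem k).2
      rw [← hα, ← h] at this
      omega
    have hint : {t | t < 0 ∧ Y α t = 0}.ncard < k := by
      by_contra! hcon
      have h1 := (eventually_ncard_interior_zeros_le hY hP hd hne hT α).and (lt_mem_nhds hα0)
      obtain ⟨β, ⟨hβ, hβ0⟩, hlt⟩ := ((h1.filter_mono nhdsWithin_le_nhds).and
        (self_mem_nhdsWithin : Iio α ∈ nhdsWithin α (Iio α))).exists
      exact (not_le.2 hlt) (csInf_le (hbdd k) ⟨hβ0.le, hcon.trans hβ⟩)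
    have hsub : {t | t ≤ 0 ∧ Y α t = 0} ⊆ insert 0 {t | t < 0 ∧ Y α t = 0} := by
      rintro t ⟨ht, h⟩
      rcases ht.lt_or_eq with h' | h'
      · exact Or.inr ⟨h', h⟩
      · exact Or.inl h'
    have hfin : {t | t < 0 ∧ Y α t = 0}.Finite :=
      (finite_zeros hY hP hd hne hT α).subset fun t ht => ⟨ht.1.le, ht.2⟩
    have hge : k ≤ n α := (hmem k).2
    have hle : n α ≤ {t | t < 0 ∧ Y α t = 0}.ncard + 1 :=
      (Set.ncard_le_ncard hsub (hfin.insert 0)).trans (Set.ncard_insert_le _ _)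
    refine ⟨?_, by omega⟩
    by_contra h0
    have : n α ≤ {t | t < 0 ∧ Y α t = 0}.ncard := by
      refine Set.ncard_le_ncard (fun t ht => ⟨lt_of_le_of_ne ht.1 ?_, ht.2⟩) hfin
      rintro rfl
      exact h0 ht.2
    omega
  set a : ℕ → ℝ := fun j => sInf (S (n 0 + 1 + j)) with ha
  have hna : ∀ j, n (a j) = n 0 + 1 + j := fun j => (hkey _ (by omega)).2
  have hmono : StrictMono a := by
    refine strictMono_nat_of_lt_succ fun j => lt_of_le_of_ne ?_ fun h => ?_
    · exact csInf_le_csInf (hbdd _) (hnon _) fun α hα => ⟨hα.1, le_trans (by omega) hα.2⟩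
    · have h1 := hna j
      have h2 := hna (j + 1)
      rw [h] at h1
      omega
  refine ⟨a, n 0 + 1, hmono, ?_, fun j => ⟨(hkey _ (by omega)).1, hna j⟩⟩
  rcases tendsto_atTop_of_monotone hmono.monotone with h | ⟨l, hl⟩
  · exact h
  · exfalso
    obtain ⟨j, hj1, hj2⟩ := ((hl.eventually (hU l)).and (eventually_ge_atTop (n l))).exists
    have := hna j
    omega

namespace IsOrbit

variable {M c : ℝ} {x y : ℝ → ℝ}

theorem sub_lt_of_neg_le_fst (h : IsOrbit M c x y) (hM : 1 ≤ M) (hM' : M ≤ 7) {a b : ℝ}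
    (hab : a ≤ b) (hb : b ≤ 0) (hy : ∀ t ∈ Icc a b, y t ≠ 0) (hx : ∀ t ∈ Icc a b, -(1 / 8) ≤ x t) :
    b - a < 400 := by
  have hsub : Icc a b ⊆ Iic 0 := fun t ht => ht.2.trans hb
  have hxc := h.continuousOn_fst.mono hsub
  have hyc := h.continuousOn_snd.mono hsub
  have hmono : MonotoneOn (fun t => arctan (x t / y t) - t / 100) (Icc a b) := by
    refine monotoneOn_of_hasDerivWithinAt_nonneg (convex_Icc a b)
      ((continuous_arctan.comp_continuousOn (hxc.div hyc hy)).sub (by fun_prop))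
      (f' := fun t => 1 / (1 + (x t / y t) ^ 2) * ((y t * y t - x t *
        (M * tanh t * y t - 2 * M * (exp (x t) - 1))) / y t ^ 2) - 1 / 100) ?_ ?_ <;>
      intro s hs <;> rw [interior_Icc] at *
    · have hs0 : s < 0 := hs.2.trans_le hb
      exact ((((h.hasDerivAt_fst s hs0).div (h.hasDerivAt_snd s hs0)
        (hy s (Ioo_subset_Icc_self hs))).arctan).sub
        ((hasDerivAt_id s).div_const 100)).hasDerivWithinAt
    · have hs0 : s < 0 := hs.2.trans_le hb
      have hys := hy s (Ioo_subset_Icc_self hs)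
      have hxs := hx s (Ioo_subset_Icc_self hs)
      have hexp : 15 / 16 * x s ^ 2 ≤ x s * (exp (x s) - 1) := by
        rcases le_total 0 (x s) with h0 | h0
        · nlinarith [add_one_le_exp (x s)]
        · have h1 : exp (x s) ≤ 1 + x s + x s ^ 2 / 2 := by
            have h2 := quadratic_le_exp_of_nonneg (neg_nonneg.2 h0)
            have h3 : exp (x s) * exp (-x s) = 1 := by rw [← exp_add]; simp
            have h4 : 1 ≤ (1 + x s + x s ^ 2 / 2) * (1 + -x s + (-x s) ^ 2 / 2) := by
              nlinarith [sq_nonneg (x s ^ 2)]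
            have h5 : 0 ≤ 1 + x s + x s ^ 2 / 2 := by nlinarith [sq_nonneg (x s + 1)]
            have h6 := mul_le_mul_of_nonneg_left h2 h5
            by_contra! hcon
            nlinarith [exp_pos (-x s)]
          nlinarith [mul_nonneg (neg_nonneg.2 h0) (sub_nonneg.2 h1), mul_nonneg (sq_nonneg (x s))
            (by linarith : 0 ≤ x s + 1 / 8)]
      have hcross : |tanh s * (x s * y s)| ≤ |x s * y s| := by
        rw [abs_mul]
        exact mul_le_of_le_one_left (abs_nonneg _)
          (abs_le.2 ⟨by linarith [one_add_tanh_nonneg s], by linarith [tanh_nonpos_of_nonpos hs0.le]⟩)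
      have hform : 1 / 100 * (x s ^ 2 + y s ^ 2) ≤
          y s * y s - x s * (M * tanh s * y s - 2 * M * (exp (x s) - 1)) := by
        have h1 := mul_le_mul_of_nonneg_left ((le_abs_self _).trans hcross) (by linarith : 0 ≤ M)
        rw [abs_mul] at h1
        have h2 := mul_le_mul_of_nonneg_left hexp (by linarith : 0 ≤ 2 * M)
        have h3 : M ^ 2 ≤ 4 * (99 / 100) * (15 / 8 * M - 1 / 100) := by nlinarith
        have h4 : 0 ≤ 99 / 100 * |y s| ^ 2 - M * (|x s| * |y s|) +
            (15 / 8 * M - 1 / 100) * |x s| ^ 2 := by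
          nlinarith [sq_nonneg (99 / 100 * |y s| - M / 2 * |x s|),
            mul_nonneg (sub_nonneg.2 h3) (sq_nonneg |x s|)]
        rw [sq_abs, sq_abs] at h4
        nlinarith
      have hpos : 0 < x s ^ 2 + y s ^ 2 := by positivity
      have heq : ∀ w, 1 / (1 + (x s / y s) ^ 2) * (w / y s ^ 2) = w / (x s ^ 2 + y s ^ 2) := by
        intro w
        field_simp
        ring
      rw [heq, sub_nonneg, le_div_iff₀ hpos]
      exact hform
  have h1 := hmono (left_mem_Icc.2 hab) (right_mem_Icc.2 hab) hab
  simp only at h1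
  have h2 := arctan_lt_pi_div_two (x b / y b)
  have h3 := neg_pi_div_two_lt_arctan (x a / y a)
  linarith [pi_lt_four]

theorem one_ninth_le_one_sub_exp {u : ℝ} (hu : u ≤ -(1 / 8)) : 1 / 9 ≤ 1 - exp u := by
  have h1 : exp u ≤ exp (-(1 / 8)) := exp_le_exp.2 hu
  have h2 := add_one_le_exp (1 / 8 : ℝ)
  have h3 : exp (1 / 8) * exp (-(1 / 8)) = 1 := by rw [← exp_add]; simp
  nlinarith [exp_pos (-(1 / 8) : ℝ)]

theorem sub_le_of_fst_le (h : IsOrbit M c x y) (hM : 1 ≤ M) {a b B : ℝ}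
    (hab : a ≤ b) (hb : b ≤ 0) (hy : (∀ t ∈ Icc a b, 0 < y t) ∨ ∀ t ∈ Icc a b, y t < 0)
    (hx : ∀ t ∈ Icc a b, x t ≤ -(1 / 8)) (hB : ∀ t ∈ Icc a b, |y t| ≤ B ∧ -B ≤ x t) :
    b - a ≤ 9 * B := by
  have hsub : Icc a b ⊆ Iic 0 := fun t ht => ht.2.trans hb
  have hxc := h.continuousOn_fst.mono hsub
  have hyc := h.continuousOn_snd.mono hsub
  have ha' := left_mem_Icc.2 hab
  have hb' := right_mem_Icc.2 hab
  obtain ⟨hya, hxa⟩ := hB a ha'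
  obtain ⟨hyb, hxb⟩ := hB b hb'
  rw [abs_le] at hya hyb
  rcases hy with hy | hy
  · have hmono : MonotoneOn (fun t => y t + M * x t - 2 / 9 * M * t) (Icc a b) := by
      refine monotoneOn_of_hasDerivWithinAt_nonneg (convex_Icc a b) (by fun_prop)
        (f' := fun t => M * tanh t * y t - 2 * M * (exp (x t) - 1) + M * y t - 2 / 9 * M * 1)
        ?_ ?_ <;> intro s hs <;> rw [interior_Icc] at *
      · have hs0 : s < 0 := hs.2.trans_le hb
        exact (((h.hasDerivAt_snd s hs0).add ((h.hasDerivAt_fst s hs0).const_mul M)).sub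
          ((hasDerivAt_id s).const_mul (2 / 9 * M))).hasDerivWithinAt
      · have h1 := one_ninth_le_one_sub_exp (hx s (Ioo_subset_Icc_self hs))
        have h2 := mul_nonneg (one_add_tanh_nonneg s) (hy s (Ioo_subset_Icc_self hs)).le
        nlinarith
    have h1 := hmono ha' hb' hab
    simp only at h1
    have h2 := hx b hb'
    have h3 := hy a ha'
    nlinarith
  · have hmono : MonotoneOn (fun t => y t - 2 / 9 * M * t) (Icc a b) := by
      refine monotoneOn_of_hasDerivWithinAt_nonneg (convex_Icc a b) (by fun_prop)
        (f' := fun t => M * tanh t * y t - 2 * M * (exp (x t) - 1) - 2 / 9 * M * 1)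
        ?_ ?_ <;> intro s hs <;> rw [interior_Icc] at *
      · have hs0 : s < 0 := hs.2.trans_le hb
        exact ((h.hasDerivAt_snd s hs0).sub
          ((hasDerivAt_id s).const_mul (2 / 9 * M))).hasDerivWithinAt
      · have h1 := one_ninth_le_one_sub_exp (hx s (Ioo_subset_Icc_self hs))
        have hs0 : s < 0 := hs.2.trans_le hb
        have h2 := mul_nonneg (neg_nonneg.2 (tanh_nonpos_of_nonpos hs0.le))
          (neg_nonneg.2 (hy s (Ioo_subset_Icc_self hs)).le)
        nlinarith
    have h1 := hmono ha' hb' hab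
    simp only at h1
    have h3 := hy b hb'
    nlinarith

theorem exists_snd_eq_zero (h : IsOrbit M c x y) (hM : 1 ≤ M) (hM' : M ≤ 7) {a B : ℝ}
    (hB0 : 0 ≤ B)
    (ha : a + (9 * B + 401) ≤ 0) (hB : ∀ t ∈ Icc a 0, |y t| ≤ B ∧ -B ≤ x t) :
    ∃ t ∈ Icc a (a + (9 * B + 401)), y t = 0 := by
  by_contra! hne
  set b := a + (9 * B + 401) with hb
  have hsub : Icc a b ⊆ Iic 0 := fun t ht => ht.2.trans ha
  have hyc := h.continuousOn_snd.mono hsub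
  have hxc := h.continuousOn_fst.mono hsub
  have hBb : ∀ t ∈ Icc a b, |y t| ≤ B ∧ -B ≤ x t := fun t ht => hB t ⟨ht.1, ht.2.trans ha⟩
  have hsign : (∀ t ∈ Icc a b, 0 < y t) ∨ ∀ t ∈ Icc a b, y t < 0 := by
    by_contra! hcon
    obtain ⟨⟨p, hp, hp'⟩, q, hq, hq'⟩ := hcon
    obtain ⟨t, ht, ht'⟩ := isPreconnected_Icc.intermediate_value hp hq hyc ⟨hp', hq'⟩
    exact hne t ht ht'
  have hderiv : ∀ s ∈ interior (Icc a b), HasDerivWithinAt x (y s) (interior (Icc a b)) s := by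
    intro s hs
    rw [interior_Icc] at *
    exact (h.hasDerivAt_fst s (hs.2.trans_le ha)).hasDerivWithinAt
  rcases hsign with hy | hy
  · have hmono : MonotoneOn x (Icc a b) :=
      monotoneOn_of_hasDerivWithinAt_nonneg (convex_Icc a b) hxc hderiv
        fun s hs => (hy s (interior_subset hs)).le
    have hm : a + (9 * B + 1) ∈ Icc a b := ⟨by linarith, by linarith⟩
    rcases le_total (x (a + (9 * B + 1))) (-(1 / 8)) with hx | hx
    · have hss : Icc a (a + (9 * B + 1)) ⊆ Icc a b := Icc_subset_Icc_right hm.2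
      have := h.sub_le_of_fst_le hM hm.1 (hm.2.trans ha) (Or.inl fun t ht => hy t (hss ht))
        (fun t ht => (hmono (hss ht) hm ht.2).trans hx) (fun t ht => hBb t (hss ht))
      linarith
    · have hss : Icc (a + (9 * B + 1)) b ⊆ Icc a b := Icc_subset_Icc_left hm.1
      have := h.sub_lt_of_neg_le_fst hM hM' hm.2 ha (fun t ht => hne t (hss ht))
        (fun t ht => hx.trans (hmono hm (hss ht) ht.1))
      linarith
  · have hanti : AntitoneOn x (Icc a b) :=
      antitoneOn_of_hasDerivWithinAt_nonpos (convex_Icc a b) hxc hderiv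
        fun s hs => (hy s (interior_subset hs)).le
    have hm : a + 400 ∈ Icc a b := ⟨by linarith, by linarith⟩
    rcases le_total (x (a + 400)) (-(1 / 8)) with hx | hx
    · have hss : Icc (a + 400) b ⊆ Icc a b := Icc_subset_Icc_left hm.1
      have := h.sub_le_of_fst_le hM hm.2 ha (Or.inr fun t ht => hy t (hss ht))
        (fun t ht => (hanti hm (hss ht) ht.1).trans hx) (fun t ht => hBb t (hss ht))
      linarith
    · have hss : Icc a (a + 400) ⊆ Icc a b := Icc_subset_Icc_right hm.2
      have := h.sub_lt_of_neg_le_fst hM hM' hm.1 (hm.2.trans ha) (fun t ht => hne t (hss ht))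
        (fun t ht => hx.trans (hanti (hss ht) hm ht.2))
      linarith

theorem energy_le (h : IsOrbit M c x y) (hM : 0 ≤ M) {k t : ℝ} (ht : t ≤ 0) (hk : 2 * t + c = k) :
    y t ^ 2 / 2 + 2 * M * (exp (x t) - 1 - x t) ≤
      (2 + 2 * M + M * exp (k + M)) ^ 2 / 2 +
        2 * M * (exp (k + M) - 1 - (k - M * exp (k + M))) := by
  have he : exp (c + M) * exp (2 * t) = exp (k + M) := by rw [← exp_add, ← hk]; ring_nf
  have h1 := h.snd_le hM ht
  have h2 := h.le_snd hM ht
  have h3 := h.le_fst hM ht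
  have h4 := h.exp_fst_le hM ht
  rw [mul_assoc, he] at h2 h3
  rw [he] at h4
  have h5 : exp (2 * t) ≤ 1 := exp_le_one_iff.2 (by linarith)
  have h6 : 0 ≤ M * exp (k + M) := by positivity
  have h7 : M * exp (2 * t) ≤ M := mul_le_of_le_one_right hM h5
  have h8 : y t ^ 2 ≤ (2 + 2 * M + M * exp (k + M)) ^ 2 :=
    sq_le_sq' (by linarith) (by linarith)
  have h9 := mul_le_mul_of_nonneg_left
    (by linarith : exp (x t) - 1 - x t ≤ exp (k + M) - 1 - (k - M * exp (k + M)))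
    (by linarith : 0 ≤ 2 * M)
  linarith

theorem exists_bound (hM : 1 ≤ M) (k : ℝ) : ∃ B : ℝ, 0 ≤ B ∧ ∀ c : ℝ, ∀ x y : ℝ → ℝ,
    IsOrbit M c x y → ∀ s ≤ 0, 2 * s + c = k → ∀ t ∈ Icc s 0, |y t| ≤ B ∧ -B ≤ x t := by
  set E := (2 + 2 * M + M * exp (k + M)) ^ 2 / 2 +
        2 * M * (exp (k + M) - 1 - (k - M * exp (k + M))) with hE
  refine ⟨max (2 * E + 1) 0, le_max_right _ _, fun c x y h s hs hk t ht => ?_⟩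
  have h1 := (h.antitoneOn_energy (by linarith) hs ht.2 ht.1).trans
    (h.energy_le (by linarith) hs hk)
  simp only [← hE] at h1
  have h2 : 0 ≤ exp (x t) - 1 - x t := by linarith [add_one_le_exp (x t)]
  have h3 := mul_le_mul_of_nonneg_right hM h2
  have h4 := exp_pos (x t)
  have h5 := le_max_left (2 * E + 1) 0
  constructor
  · nlinarith [sq_nonneg (|y t| - 1), sq_abs (y t)]
  · nlinarith [sq_nonneg (y t)]

end IsOrbit

theorem continuous_uncurry_min_of_lipschitz {Z : ℝ → ℝ → ℝ}
    (hZ : ∀ α, ContinuousOn (Z α) (Iic 0))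
    (hL : ∀ α₀, ∃ C, ∀ α ≤ α₀ + 1, ∀ t ≤ 0, |Z α t - Z α₀ t| ≤ C * |α - α₀|) :
    Continuous fun p : ℝ × ℝ => Z p.1 (min p.2 0) := by
  rw [continuous_iff_continuousAt]
  rintro ⟨α₀, t₀⟩
  obtain ⟨C, hC⟩ := hL α₀
  have h1 : Continuous fun p : ℝ × ℝ => Z α₀ (min p.2 0) :=
    (hZ α₀).comp_continuous (by fun_prop) fun p => mem_Iic.2 (min_le_right _ _)
  have h2 : Tendsto (fun p : ℝ × ℝ => Z p.1 (min p.2 0) - Z α₀ (min p.2 0)) (nhds (α₀, t₀))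
      (nhds 0) := by
    have h3 : Tendsto (fun p : ℝ × ℝ => C * |p.1 - α₀|) (nhds (α₀, t₀)) (nhds 0) := by
      have : Continuous fun p : ℝ × ℝ => C * |p.1 - α₀| := by fun_prop
      simpa using this.tendsto (α₀, t₀)
    refine squeeze_zero_norm' ?_ h3
    have h4 : ∀ᶠ p : ℝ × ℝ in nhds (α₀, t₀), p.1 < α₀ + 1 :=
      continuous_fst.continuousAt.eventually_lt_const (by simp)
    filter_upwards [h4] with p hp
    exact hC p.1 hp.le _ (min_le_right _ _)
  have h5 := h2.add (h1.tendsto (α₀, t₀))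
  simpa [ContinuousAt] using h5

section Family

variable {M κ : ℝ} {X Y : ℝ → ℝ → ℝ}

theorem IsOrbit.lipschitz_family (hM : 0 ≤ M) (h : ∀ α, IsOrbit M (α - κ) (X α) (Y α)) (α₀ : ℝ) :
    ∃ C, ∀ α ≤ α₀ + 1, ∀ t ≤ 0, |X α t - X α₀ t| ≤ C * |α - α₀| ∧
      |Y α t - Y α₀ t| ≤ C * |α - α₀| := by
  refine ⟨exp (1 + 2 * M * exp (α₀ + 1 - κ + M)), fun α hα t ht => ?_⟩
  have h1 := (h α).dist_le hM (h α₀) (B := α₀ + 1 - κ) (by linarith) (by linarith) ht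
  set Q := exp (1 + 2 * M * exp (α₀ + 1 - κ + M)) with hQ
  have hQ1 : 1 ≤ Q := one_le_exp (by positivity)
  have h2 : (α - κ - (α₀ - κ)) ^ 2 * Q ≤ (Q * (α - α₀)) ^ 2 := by
    nlinarith [mul_nonneg (mul_nonneg (by linarith : 0 ≤ Q) (sub_nonneg.2 hQ1))
      (sq_nonneg (α - α₀))]
  have h3 : |Q * (α - α₀)| = Q * |α - α₀| := by rw [abs_mul, abs_of_nonneg (by linarith)]
  have h4 : 1 ≤ exp (-t) := one_le_exp (by linarith)
  rw [← h3]
  constructor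
  · exact sq_le_sq.1 (by nlinarith [sq_nonneg (exp (-t) * (Y α t - Y α₀ t))])
  · refine sq_le_sq.1 ?_
    have h5 : (Y α t - Y α₀ t) ^ 2 ≤ (exp (-t) * (Y α t - Y α₀ t)) ^ 2 := by
      rw [mul_pow]
      exact le_mul_of_one_le_left (sq_nonneg _) (one_le_pow₀ h4)
    nlinarith [sq_nonneg (X α t - X α₀ t)]

theorem IsOrbit.exists_seq (hM : 1 ≤ M) (hM' : M ≤ 7)
    (h : ∀ α, IsOrbit M (α - κ) (X α) (Y α)) :
    ∃ (a : ℕ → ℝ) (m : ℕ), StrictMono a ∧ Tendsto a atTop atTop ∧ ∀ j, Y (a j) 0 = 0 ∧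
      {t | t ≤ 0 ∧ Y (a j) t = 0}.Finite ∧ {t | t ≤ 0 ∧ Y (a j) t = 0}.ncard = m + j := by
  have hM0 : 0 ≤ M := by linarith
  have hXc : Continuous fun p : ℝ × ℝ => X p.1 (min p.2 0) := by
    refine continuous_uncurry_min_of_lipschitz (fun α => (h α).continuousOn_fst) fun α₀ => ?_
    obtain ⟨C, hC⟩ := IsOrbit.lipschitz_family hM0 h α₀
    exact ⟨C, fun α hα t ht => (hC α hα t ht).1⟩
  have hYc : Continuous fun p : ℝ × ℝ => Y p.1 (min p.2 0) := by
    refine continuous_uncurry_min_of_lipschitz (fun α => (h α).continuousOn_snd) fun α₀ => ?_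
    obtain ⟨C, hC⟩ := IsOrbit.lipschitz_family hM0 h α₀
    exact ⟨C, fun α hα t ht => (hC α hα t ht).2⟩
  set Z : ℝ → ℝ → ℝ := fun α t => Y α (min t 0) with hZ
  set P : ℝ → ℝ → ℝ := fun α t => M * tanh (min t 0) * Y α (min t 0) -
    2 * M * (exp (X α (min t 0)) - 1) with hP
  have hset : ∀ α, {t | t ≤ 0 ∧ Z α t = 0} = {t | t ≤ 0 ∧ Y α t = 0} := by
    intro α
    ext t
    refine and_congr_right fun ht => ?_
    simp only [hZ, min_eq_left ht]
  have hZc : Continuous (Function.uncurry Z) := hYc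
  have hPc : Continuous (Function.uncurry P) := by
    have htanh : Continuous tanh := by
      simp only [funext tanh_eq_sinh_div_cosh]
      exact continuous_sinh.div continuous_cosh fun t => (cosh_pos t).ne'
    have h1 : Continuous fun p : ℝ × ℝ => tanh (min p.2 0) := htanh.comp (by fun_prop)
    exact ((h1.const_mul M).mul hYc).sub ((hXc.rexp.sub continuous_const).const_mul (2 * M))
  have hd : ∀ α, ∀ t < 0, HasDerivAt (Z α) (P α t) t := by
    intro α t ht
    simp only [hP, min_eq_left ht.le]
    refine ((h α).hasDerivAt_snd t ht).congr_of_eventuallyEq ?_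
    filter_upwards [gt_mem_nhds ht] with s hs
    simp only [hZ, min_eq_left hs.le]
  have hne : ∀ α, ∀ t ≤ 0, Z α t = 0 → P α t ≠ 0 := by
    intro α t ht hz
    simp only [hZ, hP, min_eq_left ht] at hz ⊢
    exact (h α).snd_deriv_ne_zero (by linarith) ht hz
  have hT : ∀ α₀, ∃ T, ∀ᶠ α in nhds α₀, ∀ t ≤ T, Z α t ≠ 0 := by
    intro α₀
    have h1 : Tendsto (fun t => M * exp (α₀ + 1 - κ + M) * exp (2 * t)) atBot (nhds 0) := by
      simpa using tendsto_exp_two_mul_atBot.const_mul (M * exp (α₀ + 1 - κ + M))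
    obtain ⟨T, hT, hT0⟩ := ((h1.eventually_lt_const two_pos).and (eventually_le_atBot 0)).exists
    refine ⟨T, ?_⟩
    filter_upwards [gt_mem_nhds (lt_add_one α₀)] with α hα t ht
    have ht0 := ht.trans hT0
    simp only [hZ, min_eq_left ht0]
    have h2 := (h α).le_snd hM0 ht0
    have h3 : M * exp (α - κ + M) * exp (2 * t) ≤ M * exp (α₀ + 1 - κ + M) * exp (2 * T) := by
      gcongr
    linarith
  have hunb : ∀ n : ℕ, ∃ α ≥ 0, n ≤ {t | t ≤ 0 ∧ Z α t = 0}.ncard := by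
    intro n
    obtain ⟨B, hB0, hB⟩ := IsOrbit.exists_bound hM (-κ)
    set τ := 9 * B + 401 with hτ
    have hτ0 : 0 < τ := by linarith
    refine ⟨4 * n * τ, by positivity, ?_⟩
    set α : ℝ := 4 * n * τ with hα
    have hz : ∀ i ∈ (Finset.range n : Set ℕ), ∃ t,
        (-(2 * (i : ℝ) + 1) * τ ≤ t ∧ t ≤ -(2 * (i : ℝ)) * τ) ∧ Y α t = 0 := by
      intro i hi
      have hin : (i : ℝ) + 1 ≤ n := by
        have : i < n := by simpa using hi
        exact_mod_cast this
      have hi0 : (0 : ℝ) ≤ i := i.cast_nonneg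
      obtain ⟨t, ht, ht'⟩ := (h α).exists_snd_eq_zero hM hM' (a := -(2 * (i : ℝ) + 1) * τ) (B := B)
        hB0 (by nlinarith) fun t ht => hB _ _ _ (h α) (-(2 * n * τ))
          (by have := n.cast_nonneg (α := ℝ); nlinarith [mul_nonneg this hτ0.le])
          (by rw [hα]; ring) t ⟨by nlinarith [ht.1], ht.2⟩
      exact ⟨t, ⟨ht.1, ht.2.trans (by nlinarith)⟩, ht'⟩
    choose! z hz hz0 using hz
    rw [hset]
    have hcard := Set.ncard_le_ncard_of_injOn (s := (Finset.range n : Set ℕ))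
      (t := {t | t ≤ 0 ∧ Y α t = 0}) z (fun i hi => ⟨(hz i hi).2.trans ?_, hz0 i hi⟩) ?_
      (hset α ▸ finite_zeros hZc hPc hd hne hT α)
    · rwa [Set.ncard_coe_finset, Finset.card_range] at hcard
    · have hi0 : (0 : ℝ) ≤ i := i.cast_nonneg
      nlinarith
    · have hlt : ∀ i ∈ (Finset.range n : Set ℕ), ∀ j ∈ (Finset.range n : Set ℕ), i < j →
          z j < z i := by
        intro i hi j hj hij
        have h1 : (i : ℝ) + 1 ≤ j := by exact_mod_cast hij
        have h2 := (hz i hi).1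
        have h3 := (hz j hj).2
        nlinarith
      intro i hi j hj hij
      rcases lt_trichotomy i j with h1 | h1 | h1
      · exact absurd hij (hlt i hi j hj h1).ne'
      · exact h1
      · exact absurd hij (hlt j hj i hi h1).ne
  obtain ⟨a, m, ha, hlim, hprop⟩ := exists_seq_ncard_zeros hZc hPc hd hne hT hunb
  refine ⟨a, m, ha, hlim, fun j => ⟨?_, ?_, ?_⟩⟩
  · simpa [hZ] using (hprop j).1
  · rw [← hset]
    exact finite_zeros hZc hPc hd hne hT (a j)
  · rw [← hset]
    exact (hprop j).2

end Family

theorem isOrbit_of_contDiffOn {M κ α : ℝ} {f : ℝ → ℝ} (hf : ContDiffOn ℝ 2 f (Iic (α / 2)))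
    (hode : ∀ s < α / 2, deriv (deriv f) s - M * tanh (s - α / 2) * deriv f s
      + 2 * M * (exp (f s) - 1) = 0)
    (hlim1 : Tendsto (fun s => f s - 2 * s + κ) atBot (nhds 0))
    (hlim2 : Tendsto (fun s => exp (-s) * (deriv f s - 2)) atBot (nhds 0)) :
    IsOrbit M (α - κ) (fun t => f (t + α / 2))
      (fun t => derivWithin f (Iic (α / 2)) (t + α / 2)) := by
  have hmaps : MapsTo (fun t => t + α / 2) (Iic 0) (Iic (α / 2)) := fun t ht => by
    simpa using ht
  have hnhds : ∀ s < α / 2, Iic (α / 2) ∈ nhds s := fun s hs => Iic_mem_nhds hs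
  have hderiv : ∀ s < α / 2, derivWithin f (Iic (α / 2)) s = deriv f s := fun s hs =>
    derivWithin_of_mem_nhds (hnhds s hs)
  have hshift : Tendsto (fun t : ℝ => t + α / 2) atBot atBot :=
    tendsto_atBot_add_const_right _ _ tendsto_id
  refine ⟨hf.continuousOn.comp (by fun_prop) hmaps,
    (hf.continuousOn_derivWithin (uniqueDiffOn_Iic _) (by norm_num)).comp (by fun_prop) hmaps,
    fun t ht => ?_, fun t ht => ?_, ?_, ?_⟩
  · have hs : t + α / 2 < α / 2 := by linarith
    have h1 : DifferentiableAt ℝ f (t + α / 2) :=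
      (hf.differentiableOn (by norm_num)).differentiableAt (hnhds _ hs)
    rw [hderiv _ hs]
    exact h1.hasDerivAt.comp_add_const t (α / 2)
  · have hs : t + α / 2 < α / 2 := by linarith
    have h1 : DifferentiableAt ℝ (derivWithin f (Iic (α / 2))) (t + α / 2) :=
      ((hf.derivWithin (m := 1) (uniqueDiffOn_Iic _) (by norm_num)).differentiableOn
        (by norm_num)).differentiableAt (hnhds _ hs)
    have h2 : deriv (derivWithin f (Iic (α / 2))) (t + α / 2) = deriv (deriv f) (t + α / 2) := by
      refine Filter.EventuallyEq.deriv_eq ?_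
      filter_upwards [gt_mem_nhds hs] with s hs' using hderiv s hs'
    have h3 := hode _ hs
    rw [add_sub_cancel_right] at h3
    have h4 := h1.hasDerivAt.comp_add_const t (α / 2)
    refine h4.congr_deriv ?_
    rw [h2, hderiv _ hs]
    linarith
  · have h1 := (hlim1.comp hshift).add_const (α - κ)
    rw [zero_add] at h1
    refine h1.congr fun t => ?_
    simp only [Function.comp_apply]
    ring
  · have h1 := (hlim2.comp hshift).const_mul (exp (α / 2))
    rw [mul_zero] at h1
    refine h1.congr' ?_
    filter_upwards [eventually_lt_atBot 0] with t ht
    have hs : t + α / 2 < α / 2 := by linarith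
    rw [hderiv _ hs, Function.comp_apply, ← mul_assoc, ← exp_add]
    ring_nf

theorem stmt_16 (N : ℕ) (hN : 4 ≤ N) (hN' : N ≤ 10) (κ : ℝ)
    (hκ : κ = Real.log (((N : ℝ) - 3) / ((N : ℝ) - 2)) - 2 * Real.log 2)
    -- x̃(·, α) : the solution of the non-autonomous problem, for each α
    (xt : ℝ → ℝ → ℝ)
    (hxt2 : ∀ α : ℝ, ContDiffOn ℝ 2 (xt α) (Iic (α / 2)))
    (hxtode : ∀ α : ℝ, ∀ s : ℝ, s < α / 2 →
      deriv (deriv (xt α)) s - ((N : ℝ) - 3) * Real.tanh (s - α / 2) * deriv (xt α) s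
        + 2 * ((N : ℝ) - 3) * (Real.exp (xt α s) - 1) = 0)
    (hxtlim1 : ∀ α : ℝ, Tendsto (fun s => xt α s - 2 * s + κ) atBot (nhds 0))
    (hxtlim2 : ∀ α : ℝ,
      Tendsto (fun s => Real.exp (-s) * (deriv (xt α) s - 2)) atBot (nhds 0)) :
    ∃ a : ℕ → ℝ, StrictMono a ∧ Tendsto a atTop atTop ∧
      (∀ j : ℕ, derivWithin (xt (a j)) (Iic (a j / 2)) (a j / 2) = 0) ∧
      (∀ j : ℕ, {s : ℝ | s ≤ a j / 2 ∧ derivWithin (xt (a j)) (Iic (a j / 2)) s = 0}.Finite) ∧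
      StrictMono (fun j : ℕ =>
        {s : ℝ | s ≤ a j / 2 ∧ derivWithin (xt (a j)) (Iic (a j / 2)) s = 0}.ncard) ∧
      Tendsto (fun j : ℕ =>
        {s : ℝ | s ≤ a j / 2 ∧ derivWithin (xt (a j)) (Iic (a j / 2)) s = 0}.ncard)
        atTop atTop := by
  have h4 : (4 : ℝ) ≤ N := by exact_mod_cast hN
  have h10 : (N : ℝ) ≤ 10 := by exact_mod_cast hN'
  obtain ⟨a, m, ha, hlim, hprop⟩ := IsOrbit.exists_seq (M := (N : ℝ) - 3) (by linarith)
    (by linarith) fun α => isOrbit_of_contDiffOn (hxt2 α) (hxtode α) (hxtlim1 α) (hxtlim2 α)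
  have himage : ∀ j, {s : ℝ | s ≤ a j / 2 ∧ derivWithin (xt (a j)) (Iic (a j / 2)) s = 0} =
      (fun t => t + a j / 2) ''
        {t | t ≤ 0 ∧ derivWithin (xt (a j)) (Iic (a j / 2)) (t + a j / 2) = 0} := by
    intro j
    ext s
    constructor
    · rintro ⟨h1, h2⟩
      exact ⟨s - a j / 2, ⟨by linarith, by rwa [sub_add_cancel]⟩, sub_add_cancel _ _⟩
    · rintro ⟨t, ⟨h1, h2⟩, rfl⟩
      exact ⟨by linarith, h2⟩
  have hcard : ∀ j, {s : ℝ | s ≤ a j / 2 ∧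
      derivWithin (xt (a j)) (Iic (a j / 2)) s = 0}.ncard = m + j := fun j => by
    rw [himage, Set.ncard_image_of_injective _ (add_left_injective _), (hprop j).2.2]
  refine ⟨a, ha, hlim, fun j => by simpa using (hprop j).1, fun j => ?_, ?_, ?_⟩
  · rw [himage]
    exact (hprop j).2.1.image _
  · simp only [hcard]
    exact fun i j hij => Nat.add_lt_add_left hij m
  · simp only [hcard]
    exact tendsto_atTop_mono (fun j => Nat.le_add_left j m) tendsto_id
end

section
/- Let N ≥ 4 be an integer and let p satisfy (N+1)/(N−3) < p < p_JL(N−1), where p_JL(M) := 1 + 4/(M − 4 − 2√(M−1)) if M ≥ 11 and p_JL(M) := ∞ if 2 ≤ M ≤ 10. Set q := 2/(p−1) and μ := q(N−2−q). Then there exist countably infinitely many pairwise distinct functions v ∈ C²((0,π/2]) ∩ C¹([0,π/2]) with v(θ) > 0 for all θ ∈ [0,π/2], satisfying v''(θ) + (N−2)(cos θ/sin θ) v'(θ) − μ v(θ) + v(θ)^p = 0 for all θ ∈ (0,π/2), v'(0) = 0, and v'(π/2) = 0. -/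
open Real Set

lemma abs_weighted_integral_le {Λ c r : ℝ} (hΛ : 0 < Λ) (hc : 0 ≤ c) {H : ℝ → ℝ}
    (hH : ∀ t ∈ Icc (0:ℝ) 1, |H t| ≤ c * exp (Λ * (r * t) ^ 2)) :
    |exp (-(Λ * r ^ 2)) * (r ^ 2 * ∫ t in (0:ℝ)..1, t * H t)| ≤ c / (2 * Λ) := by
  have h1 : ∫ t in (0:ℝ)..1, c * (r ^ 2 * t * exp (Λ * (r * t) ^ 2))
      = c / (2 * Λ) * (exp (Λ * r ^ 2) - 1) := by
    have := intervalIntegral.integral_eq_sub_of_hasDerivAt (a := (0:ℝ)) (b := 1)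
      (f := fun t => c / (2 * Λ) * exp (Λ * (r * t) ^ 2))
      (f' := fun t => c * (r ^ 2 * t * exp (Λ * (r * t) ^ 2))) (fun t _ => by
        have h := (((((hasDerivAt_id t).const_mul r).pow 2).const_mul Λ).exp).const_mul (c / (2 * Λ))
        refine h.congr_deriv ?_
        simp
        field_simp) (Continuous.intervalIntegrable (by fun_prop) _ _)
    rw [this]; simp; ring
  have h2 : |r ^ 2 * ∫ t in (0:ℝ)..1, t * H t| ≤ c / (2 * Λ) * (exp (Λ * r ^ 2) - 1) := by
    rw [← h1, ← intervalIntegral.integral_const_mul, ← Real.norm_eq_abs]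
    apply intervalIntegral.norm_integral_le_of_norm_le zero_le_one
    · refine Filter.Eventually.of_forall fun t ht => ?_
      have h0 := hH t ⟨ht.1.le, ht.2⟩
      rw [Real.norm_eq_abs, abs_mul, abs_mul, abs_of_nonneg (sq_nonneg r), abs_of_pos ht.1]
      calc r ^ 2 * (t * |H t|) ≤ r ^ 2 * (t * (c * exp (Λ * (r * t) ^ 2))) := by
            have := ht.1.le; gcongr
        _ = _ := by ring
    · exact Continuous.intervalIntegrable (by fun_prop) _ _
  rw [abs_mul, abs_of_pos (exp_pos _)]
  calc exp (-(Λ * r ^ 2)) * |r ^ 2 * ∫ t in (0:ℝ)..1, t * H t|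
      ≤ exp (-(Λ * r ^ 2)) * (c / (2 * Λ) * (exp (Λ * r ^ 2) - 1)) := by gcongr
    _ = c / (2 * Λ) * (1 - exp (-(Λ * r ^ 2))) := by
        rw [exp_neg]; field_simp
    _ ≤ c / (2 * Λ) * 1 := by
        gcongr; linarith [exp_pos (-(Λ * r ^ 2))]
    _ = _ := mul_one _

/-- Global solvability of a singular Volterra equation, with joint continuity in a parameter. -/
theorem exists_singular_volterra {k : ℝ → ℝ → ℝ → ℝ} {G : ℝ → ℝ → ℝ} {M L : ℝ}
    (hk : Continuous fun x : ℝ × ℝ × ℝ => k x.1 x.2.1 x.2.2)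
    (hkM : ∀ e s, ∀ x ∈ Icc (0:ℝ) 1, |k e s x| ≤ M)
    (hG : Continuous fun x : ℝ × ℝ => G x.1 x.2) (hG0 : ∀ e, G e 0 = 0)
    (hGL : ∀ e u v, |G e u - G e v| ≤ L * |u - v|) :
    ∃ u : ℝ → ℝ → ℝ, (Continuous fun x : ℝ × ℝ => u x.1 x.2) ∧
      ∀ e r, u e r = 1 + ∫ s in (0:ℝ)..r, s * ∫ x in (0:ℝ)..1, k e s x * G e (u e (s * x)) := by
  have hM : 0 ≤ M := (abs_nonneg _).trans (hkM 0 0 0 (by simp))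
  have hL : 0 ≤ L := by
    have := hGL 0 1 0
    exact le_trans (abs_nonneg _) (by simpa using this)
  set Λ : ℝ := M * L + 1 with hΛdef
  have hΛ : 0 < Λ := by positivity
  let inner (y : ℝ × ℝ → ℝ) (e s : ℝ) : ℝ :=
    ∫ x in (0:ℝ)..1, k e s x * G e (exp (Λ * (s * x) ^ 2) * y (e, s * x))
  let T (y : ℝ × ℝ → ℝ) (z : ℝ × ℝ) : ℝ :=
    exp (-(Λ * z.2 ^ 2)) * (1 + z.2 ^ 2 * ∫ t in (0:ℝ)..1, t * inner y z.1 (z.2 * t))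
  have hinner : ∀ y : ℝ × ℝ → ℝ, Continuous y → Continuous fun z : ℝ × ℝ => inner y z.1 z.2 := by
    intro y hy
    apply intervalIntegral.continuous_parametric_intervalIntegral_of_continuous'
    simp only [Function.uncurry_def]
    refine Continuous.mul (hk.comp (f := fun q : (ℝ × ℝ) × ℝ => (q.1.1, q.1.2, q.2)) (by fun_prop))
      (hG.comp (f := fun q : (ℝ × ℝ) × ℝ =>
        (q.1.1, exp (Λ * (q.1.2 * q.2) ^ 2) * y (q.1.1, q.1.2 * q.2))) (by fun_prop))
  have hT : ∀ y : ℝ × ℝ → ℝ, Continuous y → Continuous (T y) := by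
    intro y hy
    refine Continuous.mul (by fun_prop) (continuous_const.add (Continuous.mul (by fun_prop) ?_))
    apply intervalIntegral.continuous_parametric_intervalIntegral_of_continuous'
    simp only [Function.uncurry_def]
    exact continuous_snd.mul ((hinner y hy).comp
      (f := fun q : (ℝ × ℝ) × ℝ => (q.1.1, q.1.2 * q.2)) (by fun_prop))
  have hinner_sub : ∀ y y' : ℝ × ℝ → ℝ, Continuous y → Continuous y' → ∀ C, 0 ≤ C →
      (∀ z, |y z - y' z| ≤ C) → ∀ e s,
      |inner y e s - inner y' e s| ≤ M * L * C * exp (Λ * s ^ 2) := by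
    intro y y' hy hy' C hC hyy e s
    have hci : ∀ y : ℝ × ℝ → ℝ, Continuous y → Continuous fun x : ℝ =>
        k e s x * G e (exp (Λ * (s * x) ^ 2) * y (e, s * x)) := fun y hy =>
      Continuous.mul (hk.comp (f := fun x : ℝ => (e, s, x)) (by fun_prop))
      (hG.comp (f := fun x : ℝ => (e, exp (Λ * (s * x) ^ 2) * y (e, s * x))) (by fun_prop))
    simp only [inner]
    rw [← intervalIntegral.integral_sub ((hci y hy).intervalIntegrable _ _)
      ((hci y' hy').intervalIntegrable _ _), ← Real.norm_eq_abs]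
    have := intervalIntegral.norm_integral_le_of_norm_le_const (a := (0:ℝ)) (b := 1)
      (C := M * L * C * exp (Λ * s ^ 2))
      (f := fun x => k e s x * G e (exp (Λ * (s * x) ^ 2) * y (e, s * x))
        - k e s x * G e (exp (Λ * (s * x) ^ 2) * y' (e, s * x))) ?_
    · simpa using this
    intro x hx
    rw [uIoc_of_le zero_le_one] at hx
    rw [← mul_sub, norm_mul, Real.norm_eq_abs, Real.norm_eq_abs]
    have hx1 : x ^ 2 ≤ 1 := by nlinarith [hx.1, hx.2]
    calc |k e s x| * _ ≤ M * (L * |exp (Λ * (s * x) ^ 2) * y (e, s * x)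
            - exp (Λ * (s * x) ^ 2) * y' (e, s * x)|) :=
          mul_le_mul (hkM _ _ _ ⟨hx.1.le, hx.2⟩) (hGL _ _ _) (abs_nonneg _) hM
      _ = M * (L * (exp (Λ * (s * x) ^ 2) * |y (e, s * x) - y' (e, s * x)|)) := by
          rw [← mul_sub, abs_mul, abs_of_pos (exp_pos _)]
      _ ≤ M * (L * (exp (Λ * s ^ 2) * C)) := by
          have hsx : (s * x) ^ 2 ≤ s ^ 2 := by rw [mul_pow]; nlinarith [sq_nonneg s]
          have := hyy (e, s * x)
          gcongr
      _ = _ := by ring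
  have hT_sub : ∀ y y' : ℝ × ℝ → ℝ, Continuous y → Continuous y' → ∀ C, 0 ≤ C →
      (∀ z, |y z - y' z| ≤ C) → ∀ z, |T y z - T y' z| ≤ C / 2 := by
    intro y y' hy hy' C hC hyy z
    have hint : ∀ y : ℝ × ℝ → ℝ, Continuous y →
        Continuous fun t : ℝ => t * inner y z.1 (z.2 * t) := fun y hy =>
      continuous_id.mul ((hinner y hy).comp (f := fun t : ℝ => (z.1, z.2 * t)) (by fun_prop))
    have h := abs_weighted_integral_le (r := z.2) hΛ (c := M * L * C) (by positivity)
      (H := fun t => inner y z.1 (z.2 * t) - inner y' z.1 (z.2 * t))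
      (fun t _ => hinner_sub y y' hy hy' C hC hyy _ _)
    have heq : T y z - T y' z = exp (-(Λ * z.2 ^ 2)) * (z.2 ^ 2 * ∫ t in (0:ℝ)..1,
        t * (inner y z.1 (z.2 * t) - inner y' z.1 (z.2 * t))) := by
      simp only [T, mul_sub]
      rw [intervalIntegral.integral_sub ((hint y hy).intervalIntegrable _ _)
        ((hint y' hy').intervalIntegrable _ _)]
      ring
    rw [heq]
    refine h.trans ?_
    rw [div_le_div_iff₀ (by positivity) (by norm_num)]
    nlinarith
  have hT0 : ∀ z, |T 0 z| ≤ 1 := by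
    intro z
    simp only [T, inner, Pi.zero_apply, mul_zero, hG0, intervalIntegral.integral_zero, add_zero,
      mul_one]
    rw [abs_of_pos (exp_pos _), exp_le_one_iff]
    nlinarith [sq_nonneg z.2]
  let Φ (y : BoundedContinuousFunction (ℝ × ℝ) ℝ) : BoundedContinuousFunction (ℝ × ℝ) ℝ :=
    BoundedContinuousFunction.ofNormedAddCommGroup (T y) (hT y y.continuous) (1 + ‖y‖ / 2) (by
      intro z
      have h := hT_sub y 0 y.continuous continuous_const ‖y‖ (norm_nonneg _)
        (fun z => by simpa using y.norm_coe_le_norm z) z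
      have h0 := hT0 z
      rw [Real.norm_eq_abs]
      have := abs_add_le (T y z - T 0 z) (T 0 z)
      rw [sub_add_cancel] at this
      linarith)
  have hΦ : ContractingWith (1 / 2) Φ := by
    refine ⟨by norm_num, LipschitzWith.of_dist_le_mul fun y y' => ?_⟩
    rw [BoundedContinuousFunction.dist_le (by positivity)]
    intro z
    have h := hT_sub y y' y.continuous y'.continuous (dist y y') dist_nonneg
      (fun z => (Real.dist_eq _ _).symm.trans_le (BoundedContinuousFunction.dist_coe_le_dist z)) z
    rw [Real.dist_eq]
    refine h.trans (le_of_eq ?_)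
    push_cast; ring
  obtain ⟨y, hy⟩ : ∃ y, Φ y = y := ⟨_, hΦ.fixedPoint_isFixedPt⟩
  have hyT : ∀ z, T y z = y z := fun z => by
    conv_rhs => rw [← hy]
    rfl
  refine ⟨fun e r => exp (Λ * r ^ 2) * y (e, r), by fun_prop, fun e r => ?_⟩
  have h1 : exp (Λ * r ^ 2) * y (e, r) = 1 + r ^ 2 * ∫ t in (0:ℝ)..1, t * inner y e (r * t) := by
    rw [← hyT (e, r)]
    simp only [T]
    rw [← mul_assoc, ← exp_add, add_neg_cancel, exp_zero, one_mul]
  refine h1.trans ?_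
  congr 1
  rcases eq_or_ne r 0 with rfl | hr
  · simp
  · have h2 := intervalIntegral.integral_comp_mul_left (a := 0) (b := 1)
      (fun s => s * inner y e s) hr
    simp only [mul_zero, mul_one, smul_eq_mul] at h2
    have h3 : ∫ t in (0:ℝ)..1, r * t * inner y e (r * t)
        = r * ∫ t in (0:ℝ)..1, t * inner y e (r * t) := by
      rw [← intervalIntegral.integral_const_mul]; simp only [mul_assoc]
    rw [h3] at h2
    have h4 : ∫ s in (0:ℝ)..r, s * inner y e s
        = r * (r * ∫ t in (0:ℝ)..1, t * inner y e (r * t)) := by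
      rw [h2, mul_inv_cancel_left₀ hr]
    rw [sq, mul_assoc, ← h4]

/-- The rescaled geodesic radius function `sin (e r) / e`, equal to `r` for `e = 0`. -/
noncomputable def sphRadius (e r : ℝ) : ℝ := r * sinc (e * r)

lemma mul_sphRadius (e r : ℝ) : e * sphRadius e r = sin (e * r) := by
  unfold sphRadius
  rcases eq_or_ne (e * r) 0 with h | h
  · rw [← mul_assoc, h]; simp
  · rw [sinc_of_ne_zero h, ← mul_assoc, mul_div_cancel₀ _ h]

lemma sphRadius_zero_left (r : ℝ) : sphRadius 0 r = r := by simp [sphRadius]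

lemma sphRadius_zero_right (e : ℝ) : sphRadius e 0 = 0 := by simp [sphRadius]

lemma hasDerivAt_sphRadius (e r : ℝ) : HasDerivAt (sphRadius e) (cos (e * r)) r := by
  rcases eq_or_ne e 0 with rfl | he
  · have : sphRadius 0 = fun r => r := funext sphRadius_zero_left
    rw [this]; simpa using hasDerivAt_id' r
  · have : sphRadius e = fun r => sin (e * r) / e := by
      funext r; rw [← mul_sphRadius]; field_simp
    rw [this]
    refine ((((hasDerivAt_id r).const_mul e).sin).div_const e).congr_deriv ?_
    simp; field_simp

lemma continuous_sphRadius : Continuous fun x : ℝ × ℝ => sphRadius x.1 x.2 := by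
  unfold sphRadius
  exact continuous_snd.mul (continuous_sinc.comp (by fun_prop))

lemma quarter_le_sinc {y : ℝ} (h0 : 0 ≤ y) (h2 : y ≤ 2) : 1 / 4 ≤ sinc y := by
  rcases eq_or_lt_of_le h0 with rfl | hy
  · norm_num
  rw [sinc_of_ne_zero hy.ne', le_div_iff₀ hy]
  have hpi := pi_gt_three
  have hpi4 := pi_le_four
  rcases le_total y (π / 2) with h | h
  · have := mul_le_sin h0 h
    have h3 : 1 / 4 ≤ 2 / π := by rw [div_le_div_iff₀ (by norm_num) pi_pos]; linarith
    nlinarith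
  · have := mul_le_sin (x := π - y) (by linarith) (by linarith)
    rw [sin_pi_sub] at this
    have h3 : 1 / 2 ≤ 2 / π := by rw [div_le_div_iff₀ (by norm_num) pi_pos]; linarith
    nlinarith

lemma sphRadius_le (e : ℝ) {r : ℝ} (hr : 0 ≤ r) : sphRadius e r ≤ r := by
  unfold sphRadius; nlinarith [sinc_le_one (e * r)]

lemma sphRadius_ge {e r : ℝ} (he : 0 ≤ e) (hr : 0 ≤ r) (her : e * r ≤ 2) :
    r / 4 ≤ sphRadius e r := by
  unfold sphRadius; nlinarith [quarter_le_sinc (by positivity) her]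

lemma sphRadius_pos {e r : ℝ} (he : 0 ≤ e) (hr : 0 < r) (her : e * r ≤ 2) :
    0 < sphRadius e r := lt_of_lt_of_le (by positivity) (sphRadius_ge he hr.le her)

/-- The power `u ^ p` with `u` truncated to `[0, 2]`. -/
noncomputable def truncPow (p u : ℝ) : ℝ := (max 0 (min u 2)) ^ p

lemma truncPow_nonneg (p u : ℝ) : 0 ≤ truncPow p u := rpow_nonneg (le_max_left _ _) _

lemma truncPow_eq {p u : ℝ} (h0 : 0 ≤ u) (h2 : u ≤ 2) : truncPow p u = u ^ p := by
  rw [truncPow, min_eq_left h2, max_eq_right h0]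

lemma continuous_truncPow {p : ℝ} (hp : 1 < p) : Continuous (truncPow p) :=
  (show Continuous fun u : ℝ => max 0 (min u 2) by fun_prop).rpow_const
    fun _ => Or.inr (by linarith)

lemma exists_lipschitz_truncPow {p : ℝ} (hp : 1 < p) :
    ∃ L, ∀ u v, |truncPow p u - truncPow p v| ≤ L * |u - v| := by
  have h := fun x y => Convex.norm_image_sub_le_of_norm_deriv_le (x := x) (y := y) (𝕜 := ℝ) (f := fun x : ℝ => x ^ p)
    (s := Icc 0 2) (C := p * 2 ^ (p - 1)) (fun x _ => (hasDerivAt_rpow_const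
      (Or.inr hp.le)).differentiableAt) (fun x hx => by
      rw [(hasDerivAt_rpow_const (Or.inr hp.le)).deriv, norm_mul, Real.norm_eq_abs,
        Real.norm_eq_abs, abs_of_pos (by linarith), abs_of_nonneg (rpow_nonneg hx.1 _)]
      have := rpow_le_rpow hx.1 hx.2 (by linarith : 0 ≤ p - 1)
      gcongr) (convex_Icc 0 2)
  have hmem : ∀ u : ℝ, max 0 (min u 2) ∈ Icc (0:ℝ) 2 := fun u =>
    ⟨le_max_left _ _, max_le (by norm_num) (min_le_right _ _)⟩
  refine ⟨p * 2 ^ (p - 1), fun u v => (h _ _ (hmem v) (hmem u)).trans ?_⟩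
  gcongr
  rw [Real.norm_eq_abs]
  calc |max 0 (min u 2) - max 0 (min v 2)| ≤ |min u 2 - min v 2| := by
        have := abs_max_sub_max_le_max 0 (min u 2) 0 (min v 2)
        simpa using this
    _ ≤ |u - v| := by
        have := abs_min_sub_min_le_max u 2 v 2
        simpa using this

/-- A family of regular solutions of `(S ^ m u')' + S ^ m (u ^ p - e² μ u) = 0`, `u 0 = 1`,
with `u ^ p` truncated and `S = sphRadius e`, jointly continuous up to `e = 0`. -/
theorem exists_regular_family (m : ℕ) {μ p : ℝ} (hp : 1 < p) (hμ : 0 ≤ μ) :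
    ∃ u z : ℝ → ℝ → ℝ, (Continuous fun x : ℝ × ℝ => u x.1 x.2) ∧
      (Continuous fun x : ℝ × ℝ => z x.1 x.2) ∧ (∀ e, u e 0 = 1) ∧ (∀ e, z e 0 = 0) ∧
      (∀ e r, HasDerivAt (u e) (z e r) r) ∧ (∀ r, 0 ≤ r → z 0 r ≤ 0) ∧
      ∀ e r, 0 ≤ e → e ≤ 1 → 0 < r → e * r < 2 → HasDerivAt (z e)
        (e ^ 2 * μ * u e r - truncPow p (u e r)
          - m * (cos (e * r) / sphRadius e r) * z e r) r := by
  obtain ⟨L, hL⟩ := exists_lipschitz_truncPow hp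
  let sc : ℝ → ℝ := fun y => max (sinc y) (1 / 4)
  have hsc : Continuous sc := continuous_sinc.max continuous_const
  have hsc4 : ∀ y, 1 / 4 ≤ sc y := fun y => le_max_right _ _
  have hscpos : ∀ y, 0 < sc y := fun y => lt_of_lt_of_le (by norm_num) (hsc4 y)
  have hsc1 : ∀ y, sc y ≤ 1 := fun y => max_le (sinc_le_one y) (by norm_num)
  have hsc_eq : ∀ y, 0 ≤ y → y ≤ 2 → sc y = sinc y := fun y h0 h2 =>
    max_eq_left (quarter_le_sinc h0 h2)
  let k : ℝ → ℝ → ℝ → ℝ := fun e s x => x ^ m * (sc (e * (s * x)) / sc (e * s)) ^ m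
  let G : ℝ → ℝ → ℝ := fun e v => min (e ^ 2) 1 * μ * v - truncPow p v
  have hk : Continuous fun x : ℝ × ℝ × ℝ => k x.1 x.2.1 x.2.2 := by
    refine Continuous.mul (by fun_prop) (Continuous.pow (Continuous.div (by fun_prop)
      (by fun_prop) fun x => (hscpos _).ne') _)
  have hG : Continuous fun x : ℝ × ℝ => G x.1 x.2 :=
    Continuous.sub (by fun_prop) ((continuous_truncPow hp).comp continuous_snd)
  obtain ⟨u, hu, hueq⟩ := exists_singular_volterra (M := 4 ^ m) (L := μ + L) hk
    (fun e s x hx => by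
      have h1 : sc (e * (s * x)) / sc (e * s) ≤ 4 := by
        rw [div_le_iff₀ (hscpos _)]; linarith [hsc1 (e * (s * x)), hsc4 (e * s)]
      have h0 : 0 ≤ sc (e * (s * x)) / sc (e * s) := (div_pos (hscpos _) (hscpos _)).le
      rw [abs_of_nonneg (mul_nonneg (pow_nonneg hx.1 _) (pow_nonneg h0 _))]
      calc _ ≤ (1:ℝ) * 4 ^ m := mul_le_mul (pow_le_one₀ hx.1 hx.2) (pow_le_pow_left₀ h0 h1 _)
            (pow_nonneg h0 _) zero_le_one
        _ = _ := one_mul _)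
    hG (fun e => by
      simp only [G, mul_zero, zero_sub, neg_eq_zero]
      rw [truncPow_eq le_rfl (by norm_num), zero_rpow (by linarith)])
    (fun e v w => by
      have h1 : G e v - G e w = min (e ^ 2) 1 * μ * (v - w) - (truncPow p v - truncPow p w) := by
        simp only [G]; ring
      have h2 : |min (e ^ 2) 1 * μ * (v - w)| ≤ μ * |v - w| := by
        rw [abs_mul, abs_of_nonneg (mul_nonneg (le_min (sq_nonneg _) zero_le_one) hμ)]
        have := min_le_right (e ^ 2) 1
        have h3 : min (e ^ 2) 1 * μ ≤ μ := by nlinarith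
        gcongr
      rw [h1]
      have := abs_sub (min (e ^ 2) 1 * μ * (v - w)) (truncPow p v - truncPow p w)
      linarith [hL v w])
  let z : ℝ → ℝ → ℝ := fun e s => s * ∫ x in (0:ℝ)..1, k e s x * G e (u e (s * x))
  have hz : Continuous fun x : ℝ × ℝ => z x.1 x.2 := by
    refine continuous_snd.mul ?_
    apply intervalIntegral.continuous_parametric_intervalIntegral_of_continuous'
    simp only [Function.uncurry_def]
    refine Continuous.mul (hk.comp (f := fun q : (ℝ × ℝ) × ℝ => (q.1.1, q.1.2, q.2)) (by fun_prop))
      (hG.comp (f := fun q : (ℝ × ℝ) × ℝ => (q.1.1, u q.1.1 (q.1.2 * q.2))) ?_)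
    exact Continuous.prodMk (by fun_prop)
      (hu.comp (f := fun q : (ℝ × ℝ) × ℝ => (q.1.1, q.1.2 * q.2)) (by fun_prop))
  have hue : ∀ e, Continuous (u e) := fun e => hu.comp (f := fun r => (e, r)) (by fun_prop)
  have hze : ∀ e, Continuous (z e) := fun e => hz.comp (f := fun r => (e, r)) (by fun_prop)
  have hu' : ∀ e r, HasDerivAt (u e) (z e r) r := by
    intro e r
    have h : u e = fun r => 1 + ∫ s in (0:ℝ)..r, z e s := funext fun r => hueq e r
    rw [h]
    exact (intervalIntegral.integral_hasDerivAt_right ((hze e).intervalIntegrable _ _)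
      ((hze e).stronglyMeasurableAtFilter _ _) (hze e).continuousAt).const_add 1
  refine ⟨u, z, hu, hz, fun e => by rw [hueq]; simp, fun e => by simp [z], hu', ?_, ?_⟩
  · intro r hr
    refine mul_nonpos_of_nonneg_of_nonpos hr ?_
    have : 0 ≤ ∫ x in (0:ℝ)..1, -(k 0 r x * G 0 (u 0 (r * x))) := by
      apply intervalIntegral.integral_nonneg zero_le_one
      intro x hx
      have h1 : 0 ≤ k 0 r x := mul_nonneg (pow_nonneg hx.1 _)
        (pow_nonneg (div_pos (hscpos _) (hscpos _)).le _)
      have h2 : G 0 (u 0 (r * x)) ≤ 0 := by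
        simp only [G]
        have := truncPow_nonneg p (u 0 (r * x))
        norm_num
        exact this
      nlinarith
    rw [intervalIntegral.integral_neg] at this
    linarith
  · intro e r he he1 hr her
    have hS : ∀ r, 0 < r → e * r < 2 → z e r
        = (∫ τ in (0:ℝ)..r, sphRadius e τ ^ m * G e (u e τ)) / sphRadius e r ^ m := by
      intro r hr her
      have hSr := sphRadius_pos he hr her.le
      rw [eq_div_iff (pow_pos hSr _).ne']
      have h2 := intervalIntegral.integral_comp_mul_left (a := 0) (b := 1)
        (fun τ => sphRadius e τ ^ m * G e (u e τ)) hr.ne'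
      simp only [mul_zero, mul_one, smul_eq_mul] at h2
      have h3 : ∫ τ in (0:ℝ)..r, sphRadius e τ ^ m * G e (u e τ)
          = r * ∫ x in (0:ℝ)..1, sphRadius e (r * x) ^ m * G e (u e (r * x)) := by
        rw [h2, mul_inv_cancel_left₀ hr.ne']
      rw [h3]
      simp only [z]
      rw [mul_assoc, mul_comm (∫ x in (0:ℝ)..1, _) (sphRadius e r ^ m),
        ← intervalIntegral.integral_const_mul]
      congr 1
      apply intervalIntegral.integral_congr
      intro x hx
      rw [uIcc_of_le zero_le_one] at hx
      have herx : e * (r * x) ≤ 2 := by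
        have := mul_nonneg he hr.le
        nlinarith [hx.1, hx.2]
      simp only [k]
      rw [hsc_eq _ (mul_nonneg he (mul_nonneg hr.le hx.1)) herx,
        hsc_eq _ (mul_nonneg he hr.le) her.le]
      simp only [sphRadius]
      have hsr : sinc (e * r) ≠ 0 :=
        (lt_of_lt_of_le (by norm_num) (quarter_le_sinc (mul_nonneg he hr.le) her.le)).ne'
      rw [div_pow, mul_pow, mul_pow, mul_pow]
      field_simp
    have hSr := sphRadius_pos he hr her.le
    have hSc : Continuous (sphRadius e) :=
      continuous_sphRadius.comp (f := fun r => (e, r)) (by fun_prop)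
    have hI : Continuous fun τ => sphRadius e τ ^ m * G e (u e τ) :=
      (hSc.pow m).mul (hG.comp (f := fun r => (e, u e r)) (continuous_const.prodMk (hue e)))
    have hev : z e =ᶠ[nhds r] fun r =>
        (∫ τ in (0:ℝ)..r, sphRadius e τ ^ m * G e (u e τ)) / sphRadius e r ^ m := by
      have h1 : ∀ᶠ r' in nhds r, 0 < r' := lt_mem_nhds hr
      have h2 : ∀ᶠ r' in nhds r, e * r' < 2 :=
        (show Continuous fun r' => e * r' by fun_prop).continuousAt.eventually_lt_const her
      filter_upwards [h1, h2] with r' h1 h2 using hS r' h1 h2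
    refine HasDerivAt.congr_of_eventuallyEq ?_ hev
    refine ((intervalIntegral.integral_hasDerivAt_right (hI.intervalIntegrable _ _)
      (hI.stronglyMeasurableAtFilter _ _) hI.continuousAt).div
      ((hasDerivAt_sphRadius e r).pow m) (pow_pos hSr _).ne').congr_deriv ?_
    have hmin : min (e ^ 2) 1 = e ^ 2 := min_eq_left (by nlinarith)
    rw [hS r hr her]
    simp only [G, hmin]
    rcases m with _ | m
    · simp
    · simp only [Nat.add_sub_cancel, Pi.pow_apply]
      field_simp
      ring

/-- The potential energy of the autonomous part of the damped oscillator. -/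
noncomputable def potential (lam p w : ℝ) : ℝ := w ^ (p + 1) / (p + 1) - lam * w ^ 2 / 2

lemma hasDerivAt_potential {lam p : ℝ} (hp : 1 < p) (w : ℝ) :
    HasDerivAt (potential lam p) (w ^ p - lam * w) w := by
  unfold potential
  refine (((hasDerivAt_rpow_const (Or.inr (by linarith : 1 ≤ p + 1))).div_const (p + 1)).sub
    (((hasDerivAt_id' w).pow 2).const_mul lam |>.div_const 2)).congr_deriv ?_
  have : p + 1 ≠ 0 := by linarith
  simp
  field_simp

lemma continuous_potential {lam p : ℝ} (hp : 1 < p) : Continuous (potential lam p) :=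
  continuous_iff_continuousAt.2 fun w => (hasDerivAt_potential hp w).continuousAt

lemma potential_zero {lam p : ℝ} (hp : 1 < p) : potential lam p 0 = 0 := by
  simp [potential, zero_rpow (by linarith : p + 1 ≠ 0)]

lemma potential_ge {lam p A w : ℝ} (hp : 1 < p) (hA : 0 < A) (hlam : A ^ (p - 1) = lam)
    (hw : 0 ≤ w) : potential lam p A ≤ potential lam p w := by
  have hb := one_add_mul_self_le_rpow_one_add (s := w ^ 2 / A ^ 2 - 1) (p := (p + 1) / 2)
    (by have : 0 ≤ w ^ 2 / A ^ 2 := by positivity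
        linarith) (by linarith)
  have h1 : (1 + (w ^ 2 / A ^ 2 - 1)) ^ ((p + 1) / 2) = w ^ (p + 1) / A ^ (p + 1) := by
    rw [show 1 + (w ^ 2 / A ^ 2 - 1) = (w / A) ^ (2:ℝ) by rw [rpow_two]; ring,
      ← rpow_mul (by positivity), ← div_rpow hw hA.le]
    congr 1; ring
  rw [h1, le_div_iff₀ (by positivity)] at hb
  have h2 : A ^ (p + 1) = lam * A ^ 2 := by
    rw [← hlam, ← rpow_two, ← rpow_add hA]; congr 1; ring
  unfold potential
  rw [h2] at hb ⊢
  have hp1 : 0 < p + 1 := by linarith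
  rw [← sub_nonneg]
  have : w ^ (p + 1) / (p + 1) - lam * w ^ 2 / 2 - (lam * A ^ 2 / (p + 1) - lam * A ^ 2 / 2)
      = (w ^ (p + 1) - (1 + (p + 1) / 2 * (w ^ 2 / A ^ 2 - 1)) * (lam * A ^ 2)) / (p + 1) := by
    field_simp; ring
  rw [this]
  exact div_nonneg (by linarith) hp1.le

lemma potential_neg {lam p A : ℝ} (hp : 1 < p) (hA : 0 < A) (hlam : A ^ (p - 1) = lam) :
    potential lam p A < 0 := by
  have h2 : A ^ (p + 1) = lam * A ^ 2 := by
    rw [← hlam, ← rpow_two, ← rpow_add hA]; congr 1; ring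
  have hl : 0 < lam := hlam ▸ rpow_pos_of_pos hA _
  unfold potential
  rw [h2, sub_neg]
  apply div_lt_div_of_pos_left (by positivity) (by norm_num) (by linarith)

/-- Orbits of `S (S W')' + a C S W' - lam W + W ^ p = 0` with `Y = S W'`, emanating from the
origin at time `0` and positive on `(0, R)`. -/
structure IsDampedOrbit (a lam p : ℝ) (S C W Y : ℝ → ℝ) (R : ℝ) : Prop where
  contS : ContinuousOn S (Icc 0 R)
  contC : ContinuousOn C (Icc 0 R)
  contW : ContinuousOn W (Icc 0 R)
  contY : ContinuousOn Y (Icc 0 R)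
  W_zero : W 0 = 0
  Y_zero : Y 0 = 0
  S_pos : ∀ r ∈ Ioc 0 R, 0 < S r
  C_pos : ∀ r ∈ Ioo 0 R, 0 < C r
  W_pos : ∀ r ∈ Ioo 0 R, 0 < W r
  derivS : ∀ r ∈ Ioo 0 R, HasDerivAt S (C r) r
  derivW : ∀ r ∈ Ioo 0 R, HasDerivAt W (Y r / S r) r
  derivY : ∀ r ∈ Ioo 0 R, HasDerivAt Y ((-(a * C r * Y r) + lam * W r - W r ^ p) / S r) r

/-- Total energy along an orbit. -/
noncomputable def orbitEnergy (lam p : ℝ) (W Y : ℝ → ℝ) (r : ℝ) : ℝ :=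
  Y r ^ 2 / 2 + potential lam p (W r)

namespace IsDampedOrbit

variable {a lam p : ℝ} {S C W Y : ℝ → ℝ} {R : ℝ}

lemma hasDerivAt_energy (h : IsDampedOrbit a lam p S C W Y R) (hp : 1 < p) {r : ℝ}
    (hr : r ∈ Ioo 0 R) :
    HasDerivAt (orbitEnergy lam p W Y) (-(a * C r * Y r ^ 2) / S r) r := by
  have hS := (h.S_pos r ⟨hr.1, hr.2.le⟩).ne'
  refine ((((h.derivY r hr).pow 2).div_const 2).add
    ((hasDerivAt_potential hp (W r)).comp r (h.derivW r hr))).congr_deriv ?_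
  simp
  field_simp
  ring

lemma continuousOn_energy (h : IsDampedOrbit a lam p S C W Y R) (hp : 1 < p) :
    ContinuousOn (orbitEnergy lam p W Y) (Icc 0 R) :=
  ((h.contY.pow 2).div_const 2).add ((continuous_potential hp).comp_continuousOn h.contW)

lemma energy_zero (h : IsDampedOrbit a lam p S C W Y R) (hp : 1 < p) :
    orbitEnergy lam p W Y 0 = 0 := by
  simp [orbitEnergy, h.W_zero, h.Y_zero, potential_zero hp]

lemma antitoneOn_energy (h : IsDampedOrbit a lam p S C W Y R) (hp : 1 < p) (ha : 0 < a) :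
    AntitoneOn (orbitEnergy lam p W Y) (Icc 0 R) := by
  apply antitoneOn_of_deriv_nonpos (convex_Icc 0 R) (h.continuousOn_energy hp)
  · rw [interior_Icc]
    exact fun r hr => (h.hasDerivAt_energy hp hr).differentiableAt.differentiableWithinAt
  · rw [interior_Icc]
    intro r hr
    rw [(h.hasDerivAt_energy hp hr).deriv]
    have h1 := h.C_pos r hr
    have h2 := h.S_pos r ⟨hr.1, hr.2.le⟩
    exact div_nonpos_of_nonpos_of_nonneg (neg_nonpos.2 (by positivity)) h2.le

lemma energy_neg (h : IsDampedOrbit a lam p S C W Y R) (hp : 1 < p) (ha : 0 < a) {r : ℝ}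
    (hr : r ∈ Ioc 0 R) : orbitEnergy lam p W Y r < 0 := by
  have hanti := h.antitoneOn_energy hp ha
  have h0 : (0:ℝ) ∈ Icc 0 R := ⟨le_rfl, hr.1.le.trans hr.2⟩
  have hrI : r ∈ Icc 0 R := ⟨hr.1.le, hr.2⟩
  have hle := hanti h0 hrI hr.1.le
  rw [h.energy_zero hp] at hle
  refine lt_of_le_of_ne hle fun heq => ?_
  have hE : ∀ s ∈ Icc 0 r, orbitEnergy lam p W Y s = 0 := fun s hs => by
    have hsI : s ∈ Icc 0 R := ⟨hs.1, hs.2.trans hr.2⟩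
    have h1 := hanti h0 hsI hs.1
    have h2 := hanti hsI hrI hs.2
    rw [h.energy_zero hp] at h1
    linarith
  have hY : ∀ s ∈ Ioo 0 r, Y s = 0 := fun s hs => by
    have hsI : s ∈ Ioo 0 R := ⟨hs.1, hs.2.trans_le hr.2⟩
    have h1 := h.hasDerivAt_energy hp hsI
    have h2 : HasDerivAt (orbitEnergy lam p W Y) 0 s :=
      (hasDerivAt_const s (0:ℝ)).congr_of_eventuallyEq (by
        filter_upwards [Ioo_mem_nhds hs.1 hs.2] with t ht using hE t ⟨ht.1.le, ht.2.le⟩)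
    have h3 := h1.unique h2
    have hS := (h.S_pos s ⟨hsI.1, hsI.2.le⟩)
    have hC := h.C_pos s hsI
    rw [div_eq_zero_iff, or_iff_left hS.ne', neg_eq_zero] at h3
    simpa [ha.ne', hC.ne'] using h3
  have hr2 : 0 < r / 2 := half_pos hr.1
  obtain ⟨c, hc, hcs⟩ := exists_hasDerivAt_eq_slope W (fun s => Y s / S s) hr2
    (h.contW.mono (Icc_subset_Icc_right (by linarith [hr.1, hr.2])))
    fun s hs => h.derivW s ⟨hs.1, by linarith [hs.2, hr.1, hr.2]⟩
  rw [hY c ⟨hc.1, by linarith [hc.2, hr.1]⟩, h.W_zero, zero_div, sub_zero, sub_zero] at hcs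
  have h4 := h.W_pos (r / 2) ⟨hr2, by linarith [hr.1, hr.2]⟩
  have := div_pos h4 hr2
  linarith

lemma potential_lt_energy (h : IsDampedOrbit a lam p S C W Y R) (hp : 1 < p) (ha : 0 < a)
    {A : ℝ} (hA : 0 < A) (hlam : A ^ (p - 1) = lam) {r : ℝ}
    (hr : r ∈ Ioc 0 R) : potential lam p A < orbitEnergy lam p W Y r := by
  have hR : 0 < R := hr.1.trans_le hr.2
  obtain ⟨r₂, hr₂, hr₂r, hEr₂⟩ : ∃ r₂, 0 < r₂ ∧ r₂ ≤ r ∧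
      potential lam p A < orbitEnergy lam p W Y r₂ := by
    have hc := h.continuousOn_energy hp 0 ⟨le_rfl, hR.le⟩
    have hlt : potential lam p A < orbitEnergy lam p W Y 0 := by
      rw [h.energy_zero hp]; exact potential_neg hp hA hlam
    have h1 := (hc.mono (Ioc_subset_Icc_self.trans (Icc_subset_Icc_right hr.2) :
      Ioc 0 r ⊆ Icc 0 R)).eventually_const_lt hlt
    rw [nhdsWithin_Ioc_eq_nhdsGT hr.1] at h1
    have h2 : ∀ᶠ s in nhdsWithin 0 (Ioi 0), s ∈ Ioc 0 r := Ioc_mem_nhdsGT hr.1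
    obtain ⟨s, hs1, hs2⟩ := (h1.and h2).exists
    exact ⟨s, hs2.1, hs2.2, hs1⟩
  have hsub : Icc r₂ R ⊆ Icc 0 R := Icc_subset_Icc_left hr₂.le
  have hmono : MonotoneOn (fun s => S s ^ (2 * a) *
      (orbitEnergy lam p W Y s - potential lam p A)) (Icc r₂ R) := by
    have hd : ∀ s ∈ Ioo r₂ R, HasDerivAt (fun s => S s ^ (2 * a) *
        (orbitEnergy lam p W Y s - potential lam p A))
        (2 * a * C s * S s ^ (2 * a - 1) * (potential lam p (W s) - potential lam p A)) s := by
      intro s hs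
      have hsI : s ∈ Ioo 0 R := ⟨hr₂.trans hs.1, hs.2⟩
      have hS := h.S_pos s ⟨hsI.1, hsI.2.le⟩
      refine (((h.derivS s hsI).rpow_const (Or.inl hS.ne')).mul
        ((h.hasDerivAt_energy hp hsI).sub_const _)).congr_deriv ?_
      rw [rpow_sub_one hS.ne']
      simp only [orbitEnergy]
      field_simp
      ring
    apply monotoneOn_of_deriv_nonneg (convex_Icc r₂ R)
    · refine ContinuousOn.mul ?_ (((h.continuousOn_energy hp).mono hsub).sub continuousOn_const)
      exact (h.contS.mono hsub).rpow_const fun s hs =>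
        Or.inr (by positivity)
    · rw [interior_Icc]
      exact fun s hs => (hd s hs).differentiableAt.differentiableWithinAt
    · rw [interior_Icc]
      intro s hs
      rw [(hd s hs).deriv]
      have hsI : s ∈ Ioo 0 R := ⟨hr₂.trans hs.1, hs.2⟩
      have hS := h.S_pos s ⟨hsI.1, hsI.2.le⟩
      have hC := h.C_pos s hsI
      have := potential_ge hp hA hlam (h.W_pos s hsI).le
      exact mul_nonneg (by positivity) (by linarith)
  have hkey := hmono ⟨le_rfl, hr₂r.trans hr.2⟩ ⟨hr₂r, hr.2⟩ hr₂r
  have hpos : 0 < S r₂ ^ (2 * a) * (orbitEnergy lam p W Y r₂ - potential lam p A) :=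
    mul_pos (rpow_pos_of_pos (h.S_pos r₂ ⟨hr₂, hr₂r.trans hr.2⟩) _) (by linarith)
  have := (pos_iff_pos_of_mul_pos (hpos.trans_le hkey)).1 (rpow_pos_of_pos (h.S_pos r hr) _)
  linarith

lemma dist_sq_pos (h : IsDampedOrbit a lam p S C W Y R) (hp : 1 < p) (ha : 0 < a)
    {A : ℝ} (hA : 0 < A) (hlam : A ^ (p - 1) = lam) {r : ℝ}
    (hr : r ∈ Ioc 0 R) : 0 < (W r - A) ^ 2 + Y r ^ 2 := by
  have h1 := h.potential_lt_energy hp ha hA hlam hr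
  by_contra hcon
  have hY : Y r = 0 := by nlinarith [sq_nonneg (W r - A), sq_nonneg (Y r)]
  have hW : W r - A = 0 := by nlinarith [sq_nonneg (W r - A), sq_nonneg (Y r)]
  rw [orbitEnergy, hY, sub_eq_zero.1 hW] at h1
  norm_num at h1

lemma W_ne_zero (h : IsDampedOrbit a lam p S C W Y R) (hp : 1 < p) (ha : 0 < a)
    {r : ℝ} (hr : r ∈ Ioc 0 R) : W r ≠ 0 := by
  intro h0
  have h1 := h.energy_neg hp ha hr
  rw [orbitEnergy, h0, potential_zero hp] at h1
  nlinarith [sq_nonneg (Y r)]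

lemma W_rpow_lt (h : IsDampedOrbit a lam p S C W Y R) (hp : 1 < p) (ha : 0 < a)
    {r : ℝ} (hr : r ∈ Ioc 0 R) (hW : 0 < W r) : W r ^ (p - 1) < lam * (p + 1) / 2 := by
  have h1 := h.energy_neg hp ha hr
  unfold orbitEnergy potential at h1
  have h2 : W r ^ (p + 1) = W r ^ (p - 1) * W r ^ 2 := by
    rw [← rpow_two, ← rpow_add hW]; congr 1; ring
  have h3 : W r ^ (p + 1) / (p + 1) < lam * W r ^ 2 / 2 := by nlinarith [sq_nonneg (Y r)]
  rw [h2, div_lt_div_iff₀ (by linarith) (by norm_num)] at h3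
  have := sq_pos_of_pos hW
  rw [lt_div_iff₀ (by norm_num)]
  nlinarith

end IsDampedOrbit

/-- A family `u` of regular solutions (with derivative `z`) of the rescaled equation
`u'' + m (C / S) u' - e² μ u + u ^ p = 0`, together with the admissible exponents. -/
structure IsEmdenFamily (m : ℕ) (p q a lam A : ℝ) (u z : ℝ → ℝ → ℝ) : Prop where
  one_lt_p : 1 < p
  q_pos : 0 < q
  q_mul_p : q * p = q + 2
  a_pos : 0 < a
  a_eq : a = m - 1 - 2 * q
  lam_eq : lam = q * (m - 1 - q)
  A_pos : 0 < A
  A_rpow : A ^ (p - 1) = lam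
  discr : a ^ 2 < 4 * ((p - 1) * lam)
  cont_u : Continuous fun x : ℝ × ℝ => u x.1 x.2
  cont_z : Continuous fun x : ℝ × ℝ => z x.1 x.2
  u_zero : ∀ e, u e 0 = 1
  z_zero : ∀ e, z e 0 = 0
  deriv_u : ∀ e r, HasDerivAt (u e) (z e r) r
  z_nonpos : ∀ r, 0 ≤ r → z 0 r ≤ 0
  deriv_z : ∀ e r, 0 ≤ e → e ≤ 1 → 0 < r → e * r < 2 → HasDerivAt (z e)
    (e ^ 2 * (q * (m - q)) * u e r - truncPow p (u e r)
      - m * (cos (e * r) / sphRadius e r) * z e r) r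

/-- The Emden–Fowler transform `S ^ q u`. -/
noncomputable def emdenW (q : ℝ) (u : ℝ → ℝ → ℝ) (e r : ℝ) : ℝ := sphRadius e r ^ q * u e r

/-- The logarithmic derivative `S (S ^ q u)'`. -/
noncomputable def emdenY (q : ℝ) (u z : ℝ → ℝ → ℝ) (e r : ℝ) : ℝ :=
  sphRadius e r ^ q * (q * cos (e * r) * u e r + sphRadius e r * z e r)

namespace IsEmdenFamily

variable {m : ℕ} {p q a lam A : ℝ} {u z : ℝ → ℝ → ℝ}

lemma lam_pos (H : IsEmdenFamily m p q a lam A u z) : 0 < lam :=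
  H.A_rpow ▸ rpow_pos_of_pos H.A_pos _

lemma continuous_W (H : IsEmdenFamily m p q a lam A u z) :
    Continuous fun x : ℝ × ℝ => emdenW q u x.1 x.2 :=
  (continuous_sphRadius.rpow_const fun _ => Or.inr H.q_pos.le).mul H.cont_u

lemma continuous_Y (H : IsEmdenFamily m p q a lam A u z) :
    Continuous fun x : ℝ × ℝ => emdenY q u z x.1 x.2 := by
  refine (continuous_sphRadius.rpow_const fun _ => Or.inr H.q_pos.le).mul ?_
  exact (Continuous.mul (by fun_prop) H.cont_u).add (continuous_sphRadius.mul H.cont_z)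

lemma isDampedOrbit (H : IsEmdenFamily m p q a lam A u z) {e R : ℝ} (he : 0 ≤ e) (he1 : e ≤ 1)
    (heR : e * R ≤ π / 2) (hu : ∀ r ∈ Ioo 0 R, 0 < u e r ∧ u e r < 2) :
    IsDampedOrbit a lam p (sphRadius e) (fun r => cos (e * r)) (emdenW q u e)
      (emdenY q u z e) R := by
  have hmk : Continuous fun r : ℝ => (e, r) := by fun_prop
  have hpi := pi_le_four
  have her : ∀ r ∈ Ioc 0 R, e * r ≤ 2 := fun r hr => by
    have := mul_le_mul_of_nonneg_left hr.2 he
    linarith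
  have hS : ∀ r ∈ Ioc 0 R, 0 < sphRadius e r := fun r hr => sphRadius_pos he hr.1 (her r hr)
  have her2 : ∀ r ∈ Ioo 0 R, e * r < π / 2 := fun r hr => by
    rcases eq_or_lt_of_le he with rfl | he0
    · simpa using pi_pos
    · have := mul_lt_mul_of_pos_left hr.2 he0
      linarith
  have hSd : ∀ r ∈ Ioo 0 R, HasDerivAt (fun r => sphRadius e r ^ q)
      (q * cos (e * r) * (sphRadius e r ^ q / sphRadius e r)) r := fun r hr => by
    have h1 := hS r ⟨hr.1, hr.2.le⟩
    refine ((hasDerivAt_sphRadius e r).rpow_const (Or.inl h1.ne')).congr_deriv ?_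
    rw [rpow_sub_one h1.ne']; ring
  refine ⟨(continuous_sphRadius.comp hmk).continuousOn, by fun_prop, (H.continuous_W.comp hmk).continuousOn,
    (H.continuous_Y.comp hmk).continuousOn, ?_, ?_, hS, ?_, ?_, ?_, ?_, ?_⟩
  · simp [emdenW, sphRadius_zero_right, zero_rpow H.q_pos.ne']
  · simp [emdenY, sphRadius_zero_right, zero_rpow H.q_pos.ne']
  · intro r hr
    have := mul_nonneg he hr.1.le
    exact cos_pos_of_mem_Ioo ⟨by linarith [pi_pos], her2 r hr⟩
  · intro r hr
    exact mul_pos (rpow_pos_of_pos (hS r ⟨hr.1, hr.2.le⟩) _) (hu r hr).1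
  · exact fun r _ => hasDerivAt_sphRadius e r
  · intro r hr
    have h1 := hS r ⟨hr.1, hr.2.le⟩
    refine ((hSd r hr).mul (H.deriv_u e r)).congr_deriv ?_
    simp only [emdenY]
    field_simp
  · intro r hr
    have h1 := hS r ⟨hr.1, hr.2.le⟩
    have hcos : HasDerivAt (fun r => cos (e * r)) (-(e * (e * sphRadius e r))) r := by
      refine (((hasDerivAt_id r).const_mul e).cos).congr_deriv ?_
      rw [mul_sphRadius]; simp; ring
    have hz := H.deriv_z e r he he1 hr.1 (by linarith [her2 r hr, pi_lt_d2])
    have h2 : sphRadius e r ^ (q * p) = sphRadius e r ^ q * sphRadius e r ^ 2 := by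
      rw [H.q_mul_p, rpow_add h1, rpow_two]
    have hWp : emdenW q u e r ^ p = sphRadius e r ^ q * sphRadius e r ^ 2 * u e r ^ p := by
      rw [emdenW, mul_rpow (rpow_nonneg h1.le _) (hu r hr).1.le, ← rpow_mul h1.le, h2]
    have hcs : cos (e * r) ^ 2 = 1 - (e * sphRadius e r) ^ 2 := by
      rw [mul_sphRadius]; linarith [sin_sq_add_cos_sq (e * r)]
    refine ((hSd r hr).mul (((hcos.const_mul q).mul (H.deriv_u e r)).add
      ((hasDerivAt_sphRadius e r).mul hz))).congr_deriv ?_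
    rw [hWp, truncPow_eq (hu r hr).1.le (hu r hr).2.le, H.a_eq, H.lam_eq]
    simp only [emdenY, emdenW, Pi.add_apply, Pi.mul_apply]
    have h3 : sphRadius e r ≠ 0 := h1.ne'
    field_simp
    linear_combination (q * (m - 1 - q) * u e r) * hcs
end IsEmdenFamily

lemma IsDampedOrbit.W_lt {a lam p B : ℝ} {S C W Y : ℝ → ℝ} {R : ℝ}
    (h : IsDampedOrbit a lam p S C W Y R) (hp : 1 < p) (ha : 0 < a) (hB : 0 < B)
    (hBp : B ^ (p - 1) = lam * (p + 1) / 2) {r : ℝ} (hr : r ∈ Ioc 0 R) (hW : 0 < W r) :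
    W r < B := by
  have := h.W_rpow_lt hp ha hr hW
  rw [← hBp] at this
  exact (rpow_lt_rpow_iff hW.le hB.le (by linarith)).1 this

namespace IsEmdenFamily

variable {m : ℕ} {p q a lam A : ℝ} {u z : ℝ → ℝ → ℝ}

lemma exists_bound (H : IsEmdenFamily m p q a lam A u z) :
    ∃ B, 0 < B ∧ B ^ (p - 1) = lam * (p + 1) / 2 := by
  have hp := H.one_lt_p
  have h0 : 0 < lam * (p + 1) / 2 := by have := H.lam_pos; positivity
  refine ⟨(lam * (p + 1) / 2) ^ (p - 1)⁻¹, by positivity, ?_⟩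
  rw [← rpow_mul h0.le, inv_mul_cancel₀ (by linarith), rpow_one]

lemma u_zero_le_one (H : IsEmdenFamily m p q a lam A u z) {r : ℝ} (hr : 0 ≤ r) : u 0 r ≤ 1 := by
  have h : AntitoneOn (u 0) (Ici 0) := by
    apply antitoneOn_of_deriv_nonpos (convex_Ici 0)
    · exact fun r _ => (H.deriv_u 0 r).continuousAt.continuousWithinAt
    · exact fun r _ => (H.deriv_u 0 r).differentiableAt.differentiableWithinAt
    · intro r hr
      rw [interior_Ici] at hr
      rw [(H.deriv_u 0 r).deriv]
      exact H.z_nonpos r (le_of_lt hr)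
  have := h (mem_Ici.2 le_rfl) (mem_Ici.2 hr) hr
  rwa [H.u_zero] at this

lemma exists_uniform_bounds (H : IsEmdenFamily m p q a lam A u z) :
    ∃ e₀, 0 < e₀ ∧ e₀ ≤ 1 ∧ ∀ e ∈ Icc 0 e₀, ∀ r, 0 ≤ r → e * r ≤ π / 2 →
      0 < u e r ∧ u e r < 2 := by
  obtain ⟨B, hB, hBp⟩ := H.exists_bound
  have hq := H.q_pos
  set r₀ := 4 * B ^ q⁻¹ with hr₀
  have hr₀pos : 0 < r₀ := by positivity
  have hopen : IsOpen {x : ℝ × ℝ | u x.1 x.2 < 2} := isOpen_lt H.cont_u continuous_const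
  have hsub : ({0} : Set ℝ) ×ˢ Icc 0 r₀ ⊆ {x : ℝ × ℝ | u x.1 x.2 < 2} := by
    rintro ⟨e, r⟩ ⟨he, hr⟩
    simp only [mem_singleton_iff] at he
    subst he
    have := H.u_zero_le_one hr.1
    simp only [mem_ofPred_eq]; linarith
  obtain ⟨s, t, hs, -, h0s, hrt, hst⟩ :=
    generalized_tube_lemma isCompact_singleton isCompact_Icc hopen hsub
  obtain ⟨ε, hε, hball⟩ := Metric.isOpen_iff.1 hs 0 (h0s rfl)
  refine ⟨min (ε / 2) 1, by positivity, min_le_right _ _, ?_⟩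
  intro e he r hr her
  have hes : e ∈ s := hball (by
    rw [Metric.mem_ball, dist_zero_right, Real.norm_eq_abs, abs_of_nonneg he.1]
    linarith [he.2.trans (min_le_left _ _)])
  have he1 : e ≤ 1 := he.2.trans (min_le_right _ _)
  have hue : Continuous (u e) := H.cont_u.comp (f := fun r => (e, r)) (by fun_prop)
  have hpi := pi_le_four
  by_contra hcon
  set T : Set ℝ := Icc 0 r ∩ {x | ¬ (0 < u e x ∧ u e x < 2)} with hT
  have hTclosed : IsClosed T := isClosed_Icc.inter
    ((isOpen_lt continuous_const hue).inter (isOpen_lt hue continuous_const)).isClosed_compl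
  have hTne : T.Nonempty := ⟨r, ⟨hr, le_rfl⟩, hcon⟩
  have hTbdd : BddBelow T := ⟨0, fun x hx => hx.1.1⟩
  obtain ⟨⟨hx0, hxr⟩, hx⟩ := hTclosed.csInf_mem hTne hTbdd
  set x := sInf T with hxdef
  have hxpos : 0 < x := by
    rcases eq_or_lt_of_le hx0 with h | h
    · rw [← h] at hx; simp [H.u_zero] at hx
    · exact h
  have hin : ∀ y ∈ Ioo 0 x, 0 < u e y ∧ u e y < 2 := by
    intro y hy
    by_contra hny
    have : x ≤ y := csInf_le hTbdd ⟨⟨hy.1.le, hy.2.le.trans hxr⟩, hny⟩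
    linarith [hy.2]
  have hex : e * x ≤ π / 2 := (mul_le_mul_of_nonneg_left hxr he.1).trans her
  have horb := H.isDampedOrbit he.1 he1 hex hin
  have hxm : x ∈ Ioc 0 x := ⟨hxpos, le_rfl⟩
  have hW := horb.W_ne_zero H.one_lt_p H.a_pos hxm
  have hSpos := horb.S_pos x hxm
  have hu0 : u e x ≠ 0 := fun h => hW (by simp [emdenW, h])
  have hunn : 0 ≤ u e x := by
    have : x ∈ closure (Ioo 0 x) := by
      rw [closure_Ioo hxpos.ne]; exact ⟨hxpos.le, le_rfl⟩
    exact (isClosed_Ici (a := (0:ℝ))).mem_of_frequently_of_tendsto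
      (mem_closure_iff_frequently.1 this |>.mono fun y hy => (hin y hy).1.le) (hue.tendsto x)
  have hupos := lt_of_le_of_ne hunn hu0.symm
  have hu2 : 2 ≤ u e x := by by_contra h; exact hx ⟨hupos, not_le.1 h⟩
  have hxr₀ : r₀ < x := by
    by_contra h
    have : u e x < 2 := hst (mk_mem_prod hes (hrt ⟨hx0, not_lt.1 h⟩))
    linarith
  have hlt := horb.W_lt H.one_lt_p H.a_pos hB hBp hxm (mul_pos (rpow_pos_of_pos hSpos _) hupos)
  have hSge : B ^ q⁻¹ ≤ sphRadius e x := by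
    have := sphRadius_ge he.1 hx0 (by linarith : e * x ≤ 2)
    linarith
  have hSq : B ≤ sphRadius e x ^ q := by
    have := rpow_le_rpow (by positivity) hSge hq.le
    rwa [← rpow_mul hB.le, inv_mul_cancel₀ hq.ne', rpow_one] at this
  simp only [emdenW] at hlt
  nlinarith
end IsEmdenFamily

/-- Angular velocity of `(W - A, Y)` along an orbit. -/
noncomputable def angSpeed (a lam p A : ℝ) (S C W Y : ℝ → ℝ) (r : ℝ) : ℝ :=
  -(Y r ^ 2 + a * C r * (W r - A) * Y r + (W r - A) * (W r ^ p - lam * W r)) /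
    (S r * ((W r - A) ^ 2 + Y r ^ 2))

/-- A continuous determination of the angle of `(W - A, Y)`, normalised at time `b`. -/
noncomputable def orbitAngle (a lam p A : ℝ) (S C W Y : ℝ → ℝ) (b r : ℝ) : ℝ :=
  arctan (Y b / (W b - A)) + ∫ s in b..r, angSpeed a lam p A S C W Y s

lemma mul_sub_pos_of_ne {lam p A w : ℝ} (hp : 1 < p) (hA : 0 < A) (hlam : A ^ (p - 1) = lam)
    (hw : 0 < w) (hwA : w - A ≠ 0) : 0 < (w - A) * (w ^ p - lam * w) := by
  have h : w ^ p - lam * w = w * (w ^ (p - 1) - A ^ (p - 1)) := by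
    rw [hlam, rpow_sub_one hw.ne']; field_simp
  rw [h]
  rcases lt_or_gt_of_ne hwA with h1 | h1
  · have := rpow_lt_rpow hw.le (sub_neg.1 h1) (by linarith : 0 < p - 1)
    have := mul_pos hw (sub_pos.2 this)
    nlinarith
  · have := rpow_lt_rpow hA.le (sub_pos.1 h1) (by linarith : 0 < p - 1)
    have := mul_pos hw (sub_pos.2 this)
    nlinarith

namespace IsDampedOrbit

variable {a lam p A : ℝ} {S C W Y : ℝ → ℝ} {R : ℝ}

lemma continuousOn_angSpeed (h : IsDampedOrbit a lam p S C W Y R) (hp : 1 < p) (ha : 0 < a)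
    (hA : 0 < A) (hlam : A ^ (p - 1) = lam) :
    ContinuousOn (angSpeed a lam p A S C W Y) (Ioc 0 R) := by
  have hS := h.contS.mono Ioc_subset_Icc_self
  have hC := h.contC.mono Ioc_subset_Icc_self
  have hW := h.contW.mono Ioc_subset_Icc_self
  have hY := h.contY.mono Ioc_subset_Icc_self
  have hWp : ContinuousOn (fun r => W r ^ p) (Ioc 0 R) :=
    hW.rpow_const fun _ _ => Or.inr (by linarith)
  unfold angSpeed
  refine ContinuousOn.div (by fun_prop) (by fun_prop) fun r hr => ?_
  exact (mul_pos (h.S_pos r hr) (h.dist_sq_pos hp ha hA hlam hr)).ne'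

lemma intervalIntegrable_angSpeed (h : IsDampedOrbit a lam p S C W Y R) (hp : 1 < p) (ha : 0 < a)
    (hA : 0 < A) (hlam : A ^ (p - 1) = lam) {b r : ℝ} (hb : b ∈ Ioc 0 R) (hr : r ∈ Ioc 0 R) :
    IntervalIntegrable (angSpeed a lam p A S C W Y) MeasureTheory.volume b r :=
  ((h.continuousOn_angSpeed hp ha hA hlam).mono
    (OrdConnected.uIcc_subset ordConnected_Ioc hb hr)).intervalIntegrable

lemma hasDerivAt_orbitAngle (h : IsDampedOrbit a lam p S C W Y R) (hp : 1 < p) (ha : 0 < a)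
    (hA : 0 < A) (hlam : A ^ (p - 1) = lam) {b r : ℝ} (hb : b ∈ Ioc 0 R) (hr : r ∈ Ioo 0 R) :
    HasDerivAt (orbitAngle a lam p A S C W Y b) (angSpeed a lam p A S C W Y r) r := by
  have hc := (h.continuousOn_angSpeed hp ha hA hlam).mono Ioo_subset_Ioc_self
  unfold orbitAngle
  exact (intervalIntegral.integral_hasDerivAt_right
    (h.intervalIntegrable_angSpeed hp ha hA hlam hb ⟨hr.1, hr.2.le⟩)
    (hc.stronglyMeasurableAtFilter isOpen_Ioo r hr)
    (hc.continuousAt (isOpen_Ioo.mem_nhds hr))).const_add _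

lemma continuousOn_orbitAngle (h : IsDampedOrbit a lam p S C W Y R) (hp : 1 < p) (ha : 0 < a)
    (hA : 0 < A) (hlam : A ^ (p - 1) = lam) {b : ℝ} (hb : b ∈ Ioc 0 R) :
    ContinuousOn (orbitAngle a lam p A S C W Y b) (Icc b R) := by
  unfold orbitAngle
  have := intervalIntegral.continuousOn_primitive_interval' (a := b)
    (h.intervalIntegrable_angSpeed hp ha hA hlam hb ⟨hb.1.trans_le hb.2, le_rfl⟩) left_mem_uIcc
  rw [uIcc_of_le hb.2] at this
  exact this.const_add _

lemma orbitAngle_spec (h : IsDampedOrbit a lam p S C W Y R) (hp : 1 < p) (ha : 0 < a)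
    (hA : 0 < A) (hlam : A ^ (p - 1) = lam) {b r : ℝ} (hb : b ∈ Ioc 0 R) (hbA : W b < A)
    (hr : r ∈ Icc b R) :
    Y r * cos (orbitAngle a lam p A S C W Y b r) =
      (W r - A) * sin (orbitAngle a lam p A S C W Y b r) := by
  set φ := orbitAngle a lam p A S C W Y b with hφ
  set D : ℝ → ℝ := fun r => Y r * cos (φ r) - (W r - A) * sin (φ r) with hD
  set Q : ℝ → ℝ := fun r => (W r - A) ^ 2 + Y r ^ 2 with hQ
  have hQpos : ∀ r ∈ Ioc 0 R, 0 < Q r := fun r hr => h.dist_sq_pos hp ha hA hlam hr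
  have hbR : Icc b R ⊆ Ioc 0 R := fun x hx => ⟨hb.1.trans_le hx.1, hx.2⟩
  have hcφ := h.continuousOn_orbitAngle hp ha hA hlam hb
  have hcW := h.contW.mono (hbR.trans Ioc_subset_Icc_self)
  have hcY := h.contY.mono (hbR.trans Ioc_subset_Icc_self)
  have hcont : ContinuousOn (fun r => D r ^ 2 / Q r) (Icc b R) := by
    refine ContinuousOn.div ?_ (by fun_prop) fun x hx => (hQpos x (hbR hx)).ne'
    exact ((hcY.mul (continuous_cos.comp_continuousOn hcφ)).sub
      ((hcW.sub continuousOn_const).mul (continuous_sin.comp_continuousOn hcφ))).pow 2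
  have hder : ∀ x ∈ Ioo b R, HasDerivAt (fun r => D r ^ 2 / Q r) 0 x := by
    intro x hx
    have hx0 : x ∈ Ioo 0 R := ⟨hb.1.trans hx.1, hx.2⟩
    have hS := h.S_pos x ⟨hx0.1, hx0.2.le⟩
    have hQx := hQpos x ⟨hx0.1, hx0.2.le⟩
    have dφ := h.hasDerivAt_orbitAngle hp ha hA hlam hb hx0
    have dW := (h.derivW x hx0).sub_const A
    have dY := h.derivY x hx0
    have dD := (dY.mul dφ.cos).sub (dW.mul dφ.sin)
    have dQ := (dW.pow 2).add (dY.pow 2)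
    refine ((dD.pow 2).div dQ hQx.ne').congr_deriv ?_
    simp only [Pi.sub_apply, Pi.mul_apply, Pi.add_apply, Pi.pow_apply, ← hφ, angSpeed]
    have hQ' : (W x - A) ^ 2 + Y x ^ 2 ≠ 0 := hQx.ne'
    generalize cos (φ x) = c
    generalize sin (φ x) = s
    field_simp
    ring
  have hconst : D r ^ 2 / Q r = D b ^ 2 / Q b := by
    rcases eq_or_lt_of_le hr.1 with rfl | hlt
    · rfl
    obtain ⟨c, hc, hcs⟩ := exists_hasDerivAt_eq_slope (fun r => D r ^ 2 / Q r) (fun _ => 0) hlt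
      (hcont.mono (Icc_subset_Icc_right hr.2)) fun x hx => hder x ⟨hx.1, hx.2.trans_le hr.2⟩
    have := sub_pos.2 hlt
    rw [eq_comm, div_eq_zero_iff, or_iff_left this.ne', sub_eq_zero] at hcs
    exact hcs
  have hDb : D b = 0 := by
    have hne : W b - A ≠ 0 := (sub_neg.2 hbA).ne
    simp only [hD, hφ, orbitAngle, intervalIntegral.integral_same, add_zero]
    rw [cos_arctan, sin_arctan]
    field_simp
    ring
  rw [hDb, zero_pow two_ne_zero, zero_div, div_eq_zero_iff,
    or_iff_left (hQpos r (hbR hr)).ne', sq_eq_zero_iff] at hconst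
  linarith

lemma Y_eq_zero_of_angle (h : IsDampedOrbit a lam p S C W Y R) (hp : 1 < p) (ha : 0 < a)
    (hA : 0 < A) (hlam : A ^ (p - 1) = lam) {b r : ℝ} (hb : b ∈ Ioc 0 R) (hbA : W b < A)
    (hr : r ∈ Icc b R) {k : ℕ} (hk : orbitAngle a lam p A S C W Y b r = -(k * π)) : Y r = 0 := by
  have := h.orbitAngle_spec hp ha hA hlam hb hbA hr
  rw [hk, sin_neg, sin_nat_mul_pi, neg_zero, mul_zero, mul_eq_zero] at this
  refine this.resolve_right fun h0 => ?_
  have h1 := sin_sq_add_cos_sq (-(k * π))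
  rw [h0, sin_neg, sin_nat_mul_pi] at h1
  norm_num at h1

lemma angle_le_of_le (h : IsDampedOrbit a lam p S C W Y R) (hp : 1 < p) (ha : 0 < a)
    (hA : 0 < A) (hlam : A ^ (p - 1) = lam) {b r₁ r : ℝ} (hb : b ∈ Ioc 0 R) (hbA : W b < A)
    (hr₁ : b ≤ r₁) (hr : r ∈ Icc r₁ R) {k : ℕ}
    (hk : orbitAngle a lam p A S C W Y b r₁ ≤ -(k * π)) :
    orbitAngle a lam p A S C W Y b r ≤ -(k * π) := by
  refine image_le_of_deriv_right_lt_deriv_boundary (f' := angSpeed a lam p A S C W Y)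
    (B := fun _ => -(k * π)) (B' := fun _ => 0)
    ((h.continuousOn_orbitAngle hp ha hA hlam hb).mono (Icc_subset_Icc_left hr₁))
    (fun x hx => ?_) hk (fun x => hasDerivAt_const x _) (fun x hx hxk => ?_) hr
  · exact (h.hasDerivAt_orbitAngle hp ha hA hlam hb
      ⟨hb.1.trans_le (hr₁.trans hx.1), hx.2⟩).hasDerivWithinAt
  · have hx0 : x ∈ Ioo 0 R := ⟨hb.1.trans_le (hr₁.trans hx.1), hx.2⟩
    have hx1 : x ∈ Ioc 0 R := Ioo_subset_Ioc_self hx0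
    have hY := h.Y_eq_zero_of_angle hp ha hA hlam hb hbA ⟨hr₁.trans hx.1, hx.2.le⟩ hxk
    have hQ := h.dist_sq_pos hp ha hA hlam hx1
    have hne : W x - A ≠ 0 := fun h0 => by rw [h0, hY] at hQ; norm_num at hQ
    have hg := mul_sub_pos_of_ne hp hA hlam (h.W_pos x hx0) hne
    have hS := h.S_pos x hx1
    unfold angSpeed
    refine div_neg_of_neg_of_pos ?_ (mul_pos hS hQ)
    rw [hY]; linarith

end IsDampedOrbit

lemma exists_lt_of_mul_deriv_le {f f' : ℝ → ℝ} {r₁ d : ℝ} (hr₁ : 0 < r₁) (hd : 0 < d)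
    (hf : ∀ r, r₁ ≤ r → HasDerivAt f (f' r) r) (hle : ∀ r, r₁ ≤ r → r * f' r ≤ -d) (M : ℝ) :
    ∃ r, r₁ ≤ r ∧ f r < M := by
  have hd' : ∀ r, r₁ ≤ r → HasDerivAt (fun r => f r + d * log r) (f' r + d * r⁻¹) r :=
    fun r hr => (hf r hr).add ((hasDerivAt_log (hr₁.trans_le hr).ne').const_mul d)
  have hanti : AntitoneOn (fun r => f r + d * log r) (Ici r₁) := by
    apply antitoneOn_of_deriv_nonpos (convex_Ici r₁)
    · exact fun r hr => (hd' r hr).continuousAt.continuousWithinAt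
    · exact fun r hr => (hd' r (interior_subset hr)).differentiableAt.differentiableWithinAt
    · intro r hr
      have hr' : r₁ ≤ r := interior_subset hr
      have hrpos := hr₁.trans_le hr'
      rw [(hd' r hr').deriv]
      have := hle r hr'
      rw [← mul_le_mul_iff_right₀ hrpos, mul_add, mul_zero, mul_left_comm,
        mul_inv_cancel₀ hrpos.ne']
      linarith
  set t := |f r₁ - M| / d + 1
  have ht : 0 ≤ t := by positivity
  have hr : r₁ ≤ r₁ * exp t := by nlinarith [one_le_exp ht]
  refine ⟨r₁ * exp t, hr, ?_⟩
  have h1 := hanti (mem_Ici.2 le_rfl) (mem_Ici.2 hr) hr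
  simp only [log_mul hr₁.ne' (exp_pos t).ne', log_exp] at h1
  have h2 : d * t = |f r₁ - M| + d := by simp only [t]; field_simp
  nlinarith [le_abs_self (f r₁ - M)]

/-- The slope `(w ^ p - lam w) / (w - A)` of the restoring force is positive and tends to
`(p - 1) lam` at the equilibrium `A`. -/
lemma exists_force_bounds {lam p A : ℝ} (hp : 1 < p) (hA : 0 < A) (hlam : A ^ (p - 1) = lam)
    {w₁ w₂ : ℝ} (hw₁ : 0 < w₁) (hwA : w₁ ≤ A) (hAw : A ≤ w₂) :
    ∃ c, 0 < c ∧ ∀ w ∈ Icc w₁ w₂, c * (w - A) ^ 2 ≤ (w - A) * (w ^ p - lam * w) := by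
  set g : ℝ → ℝ := fun w => w ^ p - lam * w with hg
  have hgA : g A = 0 := by
    simp only [hg, ← hlam]; rw [rpow_sub_one hA.ne']; field_simp; ring
  have hgd : ∀ w, HasDerivAt g (p * w ^ (p - 1) - lam) w := fun w =>
    ((hasDerivAt_rpow_const (Or.inr hp.le)).sub ((hasDerivAt_id w).const_mul lam)).congr_deriv
      (by simp)
  have hc : ContinuousOn (dslope g A) (Icc w₁ w₂) := by
    refine ContinuousOn.mono ?_ (subset_univ _)
    rw [continuousOn_dslope Filter.univ_mem]
    exact ⟨fun w _ => (hgd w).continuousAt.continuousWithinAt, (hgd A).differentiableAt⟩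
  have hmul : ∀ w, (w - A) * (w ^ p - lam * w) = dslope g A w * (w - A) ^ 2 := fun w => by
    have := sub_smul_dslope g A w
    rw [hgA, sub_zero, smul_eq_mul] at this
    rw [show w ^ p - lam * w = g w from rfl, ← this]; ring
  obtain ⟨w, hw, hmin⟩ := isCompact_Icc.exists_isMinOn (nonempty_Icc.2 (hwA.trans hAw)) hc
  refine ⟨dslope g A w, ?_, fun x hx => ?_⟩
  · rcases eq_or_ne w A with rfl | hne
    · rw [dslope_same, (hgd w).deriv, hlam]
      have : 0 < lam := hlam ▸ rpow_pos_of_pos hA _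
      nlinarith
    · have h1 := mul_sub_pos_of_ne hp hA hlam (hw₁.trans_le hw.1) (sub_ne_zero.2 hne)
      rw [hmul] at h1
      exact pos_of_mul_pos_left h1 (sq_nonneg _)
  · rw [hmul]
    exact mul_le_mul_of_nonneg_right (hmin hx) (sq_nonneg _)

lemma exists_force_bound_near {lam p A : ℝ} (hp : 1 < p) (hA : 0 < A) (hlam : A ^ (p - 1) = lam)
    {h₀ : ℝ} (hh : h₀ < (p - 1) * lam) :
    ∃ δ, 0 < δ ∧ ∀ w, |w - A| < δ → h₀ * (w - A) ^ 2 ≤ (w - A) * (w ^ p - lam * w) := by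
  set g : ℝ → ℝ := fun w => w ^ p - lam * w with hg
  have hgA : g A = 0 := by
    simp only [hg, ← hlam]; rw [rpow_sub_one hA.ne']; field_simp; ring
  have hgd : HasDerivAt g (p * A ^ (p - 1) - lam) A :=
    ((hasDerivAt_rpow_const (Or.inr hp.le)).sub ((hasDerivAt_id A).const_mul lam)).congr_deriv
      (by simp)
  have hc : ContinuousAt (dslope g A) A := continuousAt_dslope_same.2 hgd.differentiableAt
  have hev : ∀ᶠ w in nhds A, h₀ < dslope g A w := hc.eventually_const_lt (by
    rw [dslope_same, hgd.deriv, hlam]; linarith)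
  obtain ⟨δ, hδ, hball⟩ := Metric.eventually_nhds_iff.1 hev
  refine ⟨δ, hδ, fun w hw => ?_⟩
  have := sub_smul_dslope g A w
  rw [hgA, sub_zero, smul_eq_mul] at this
  rw [show w ^ p - lam * w = g w from rfl, ← this]
  nlinarith [hball (y := w) hw, sq_nonneg (w - A)]

/-- Quadratic lower bound for the potential at its minimum. -/
lemma potential_quadratic_bound {lam p A : ℝ} (hp : 1 < p) {w₁ w₂ c : ℝ}
    (hc : ∀ w ∈ Icc w₁ w₂, c * (w - A) ^ 2 ≤ (w - A) * (w ^ p - lam * w))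
    (hwA : w₁ ≤ A) (hAw : A ≤ w₂) {w : ℝ} (hw : w ∈ Icc w₁ w₂) :
    c / 2 * (w - A) ^ 2 ≤ potential lam p w - potential lam p A := by
  set K : ℝ → ℝ := fun w => potential lam p w - c / 2 * (w - A) ^ 2 with hK
  have hKd : ∀ w, HasDerivAt K (w ^ p - lam * w - c * (w - A)) w := fun w =>
    ((hasDerivAt_potential hp w).sub ((((hasDerivAt_id w).sub_const A).pow 2).const_mul
      (c / 2))).congr_deriv (by simp; ring)
  have hKA : K A = potential lam p A := by simp [hK]
  have hKc : Continuous K := continuous_iff_continuousAt.2 fun w => (hKd w).continuousAt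
  suffices K A ≤ K w by rw [hKA] at this; simp only [hK] at this; linarith
  rcases le_total w A with h | h
  · refine antitoneOn_of_deriv_nonpos (convex_Icc w A) hKc.continuousOn
      (fun x _ => (hKd x).differentiableAt.differentiableWithinAt) (fun x hx => ?_)
      ⟨le_rfl, h⟩ ⟨h, le_rfl⟩ h
    rw [interior_Icc] at hx
    rw [(hKd x).deriv]
    have h1 := hc x ⟨hw.1.trans hx.1.le, hx.2.le.trans hAw⟩
    have h2 : x - A < 0 := sub_neg.2 hx.2
    by_contra hcon
    nlinarith
  · refine monotoneOn_of_deriv_nonneg (convex_Icc A w) hKc.continuousOn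
      (fun x _ => (hKd x).differentiableAt.differentiableWithinAt) (fun x hx => ?_)
      ⟨le_rfl, h⟩ ⟨h, le_rfl⟩ h
    rw [interior_Icc] at hx
    rw [(hKd x).deriv]
    have h1 := hc x ⟨hwA.trans hx.1.le, hx.2.le.trans hw.2⟩
    have h2 : 0 < x - A := sub_pos.2 hx.1
    by_contra hcon
    nlinarith

lemma exists_quadratic_form_bound {a h₀ : ℝ} (h : a ^ 2 < 4 * h₀) :
    ∃ d, 0 < d ∧ ∀ x y : ℝ, d * (x ^ 2 + y ^ 2) ≤ y ^ 2 + a * x * y + h₀ * x ^ 2 := by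
  have hh : 0 < h₀ := by nlinarith [sq_nonneg a]
  set d := (h₀ - a ^ 2 / 4) / (1 + h₀) with hd
  have hd0 : 0 < d := div_pos (by linarith) (by linarith)
  have hdm : d * (1 + h₀) = h₀ - a ^ 2 / 4 := by rw [hd]; field_simp
  have hd1 : d < 1 := by rw [hd, div_lt_one (by linarith)]; nlinarith [sq_nonneg a]
  refine ⟨d, hd0, fun x y => ?_⟩
  have h1 : 0 < 1 - d := by linarith
  have key : 0 ≤ (1 - d) * (y ^ 2 + a * x * y + h₀ * x ^ 2 - d * (x ^ 2 + y ^ 2)) := by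
    have : (1 - d) * (y ^ 2 + a * x * y + h₀ * x ^ 2 - d * (x ^ 2 + y ^ 2)) =
        ((1 - d) * y + a * x / 2) ^ 2 + d ^ 2 * x ^ 2 := by
      linear_combination (-x ^ 2) * hdm
    rw [this]; positivity
  have := nonneg_of_mul_nonneg_right key h1
  linarith

namespace IsDampedOrbit

variable {a lam p A : ℝ} {W Y : ℝ → ℝ}

/-- A global orbit comes arbitrarily close to the equilibrium. -/
lemma exists_dist_sq_lt (h : ∀ R, IsDampedOrbit a lam p (fun r => r) (fun _ => 1) W Y R)
    (hp : 1 < p) (ha : 0 < a) (hA : 0 < A) (hlam : A ^ (p - 1) = lam) {b c : ℝ} (hb : 0 < b)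
    (hc0 : 0 < c)
    (hc : ∀ r, b ≤ r → c * (W r - A) ^ 2 ≤ (W r - A) * (W r ^ p - lam * W r))
    (hcF : ∀ r, b ≤ r → c / 2 * (W r - A) ^ 2 ≤ potential lam p (W r) - potential lam p A)
    {η : ℝ} (hη : 0 < η) : ∃ r, b ≤ r ∧ (W r - A) ^ 2 + Y r ^ 2 < η := by
  by_contra! hcon
  have hin : ∀ r, b ≤ r → r ∈ Ioo 0 (r + 1) := fun r hr => ⟨hb.trans_le hr, by linarith⟩
  set κ := a / (2 * (1 + a ^ 2 / (2 * c))) with hκ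
  have hκ0 : 0 < κ := by positivity
  have hκm : κ + κ * (a ^ 2 / (2 * c)) = a / 2 := by rw [hκ]; field_simp
  set d := min (a / 2) (κ * c / 2) with hd
  have hd0 : 0 < d := by positivity
  have hV : ∀ r, b ≤ r → HasDerivAt (fun r => orbitEnergy lam p W Y r + κ * ((W r - A) * Y r))
      ((-(a * 1 * Y r ^ 2) / r) + κ * (Y r / r * Y r + (W r - A) *
        ((-(a * 1 * Y r) + lam * W r - W r ^ p) / r))) r := fun r hr =>
    ((h (r + 1)).hasDerivAt_energy hp (hin r hr)).add
      (((((h (r + 1)).derivW r (hin r hr)).sub_const A).mul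
        ((h (r + 1)).derivY r (hin r hr))).const_mul κ)
  obtain ⟨r, hr, hlt⟩ := exists_lt_of_mul_deriv_le hb (mul_pos hd0 hη) hV (fun r hr => by
    have hr0 : r ≠ 0 := (hb.trans_le hr).ne'
    have h1 := hcon r hr
    have h2 := hc r hr
    have e : r * ((-(a * 1 * Y r ^ 2) / r) + κ * (Y r / r * Y r + (W r - A) *
        ((-(a * 1 * Y r) + lam * W r - W r ^ p) / r))) = -(a * Y r ^ 2) + κ * (Y r ^ 2
        - a * ((W r - A) * Y r) - (W r - A) * (W r ^ p - lam * W r)) := by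
      field_simp; ring
    rw [e]
    have h3 : -(a * ((W r - A) * Y r)) ≤ c / 2 * (W r - A) ^ 2 + a ^ 2 / (2 * c) * Y r ^ 2 := by
      have : 0 ≤ (c * (W r - A) + a * Y r) ^ 2 / (2 * c) := by positivity
      have e2 : (c * (W r - A) + a * Y r) ^ 2 / (2 * c) = c / 2 * (W r - A) ^ 2
        + a ^ 2 / (2 * c) * Y r ^ 2 + a * ((W r - A) * Y r) := by field_simp; ring
      linarith
    have h4 : -(a * Y r ^ 2) + κ * (Y r ^ 2
        - a * ((W r - A) * Y r) - (W r - A) * (W r ^ p - lam * W r)) ≤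
        -(a / 2 * Y r ^ 2) - κ * c / 2 * (W r - A) ^ 2 := by
      have h5 : Y r ^ 2 - a * ((W r - A) * Y r) - (W r - A) * (W r ^ p - lam * W r) ≤
        Y r ^ 2 + a ^ 2 / (2 * c) * Y r ^ 2 - c / 2 * (W r - A) ^ 2 := by linarith
      have h6 := mul_le_mul_of_nonneg_left h5 hκ0.le
      linear_combination h6 + Y r ^ 2 * hκm
    have h7 := mul_le_mul_of_nonneg_right (min_le_left (a / 2) (κ * c / 2)) (sq_nonneg (Y r))
    have h8 := mul_le_mul_of_nonneg_right (min_le_right (a / 2) (κ * c / 2))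
      (sq_nonneg (W r - A))
    have h9 := mul_le_mul_of_nonneg_left h1 hd0.le
    rw [← hd] at h7 h8
    linarith) (potential lam p A * (1 + κ / c + κ))
  have hrm : r ∈ Ioc 0 (r + 1) := Ioo_subset_Ioc_self (hin r hr)
  have e1 := (h (r + 1)).energy_neg hp ha hrm
  have e2 := (h (r + 1)).potential_lt_energy hp ha hA hlam hrm
  have e3 := hcF r hr
  have hX : (W r - A) ^ 2 ≤ -(2 * potential lam p A / c) := by
    rw [← neg_div, le_div_iff₀ hc0]
    unfold orbitEnergy at e1
    nlinarith [sq_nonneg (Y r)]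
  have hY : Y r ^ 2 ≤ -(2 * potential lam p A) := by
    unfold orbitEnergy at e1
    nlinarith [sq_nonneg (W r - A)]
  have hXY : -(((W r - A) ^ 2 + Y r ^ 2) / 2) ≤ (W r - A) * Y r := by
    nlinarith [sq_nonneg (W r - A + Y r)]
  have h6 := mul_le_mul_of_nonneg_left (show potential lam p A / c + potential lam p A ≤
    (W r - A) * Y r by linear_combination hXY + hX / 2 + hY / 2) hκ0.le
  have e4 : potential lam p A * (1 + κ / c + κ) = potential lam p A +
    κ * (potential lam p A / c + potential lam p A) := by ring
  linarith

/-- Below the discriminant threshold, global orbits spiral infinitely often. -/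
theorem exists_orbitAngle_lt
    (h : ∀ R, IsDampedOrbit a lam p (fun r => r) (fun _ => 1) W Y R)
    (hp : 1 < p) (ha : 0 < a) (hA : 0 < A) (hlam : A ^ (p - 1) = lam)
    (hdisc : a ^ 2 < 4 * ((p - 1) * lam)) {B : ℝ} (hB : 0 < B)
    (hBp : B ^ (p - 1) = lam * (p + 1) / 2) {b : ℝ} (hb : 0 < b) (M : ℝ) :
    ∃ r, b ≤ r ∧ orbitAngle a lam p A (fun r => r) (fun _ => 1) W Y b r < M := by
  have hin : ∀ r, b ≤ r → r ∈ Ioo 0 (r + 1) := fun r hr => ⟨hb.trans_le hr, by linarith⟩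
  have hin' : ∀ r, b ≤ r → r ∈ Ioc 0 (r + 1) := fun r hr => Ioo_subset_Ioc_self (hin r hr)
  have hlam0 : 0 < lam := hlam ▸ rpow_pos_of_pos hA _
  have hEb := (h (b + 1)).energy_neg hp ha (hin' b le_rfl)
  set w₁ := √(-(2 * orbitEnergy lam p W Y b / lam)) with hw₁
  have hw₁sq : w₁ ^ 2 = -(2 * orbitEnergy lam p W Y b / lam) := by
    apply sq_sqrt
    rw [← neg_div]
    exact div_nonneg (by linarith) hlam0.le
  have hw₁pos : 0 < w₁ := by
    apply sqrt_pos.2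
    rw [← neg_div]
    exact div_pos (by linarith) hlam0
  have hanti : ∀ s r, b ≤ s → s ≤ r → orbitEnergy lam p W Y r ≤ orbitEnergy lam p W Y s :=
    fun s r hs hsr => (h r).antitoneOn_energy hp ha ⟨hb.le.trans hs, hsr⟩
      ⟨(hb.le.trans hs).trans hsr, le_rfl⟩ hsr
  have hWmem : ∀ r, b ≤ r → W r ∈ Icc (min w₁ A) (max B A) := by
    intro r hr
    have hWpos := (h (r + 1)).W_pos r (hin r hr)
    refine ⟨(min_le_left _ _).trans ?_, le_max_of_le_left
      ((h (r + 1)).W_lt hp ha hB hBp (hin' r hr) hWpos).le⟩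
    have h1 := hanti b r le_rfl hr
    refine le_of_sq_le_sq ?_ hWpos.le
    rw [hw₁sq, ← neg_div, div_le_iff₀ hlam0]
    have h2 : orbitEnergy lam p W Y r = Y r ^ 2 / 2 + (W r ^ (p + 1) / (p + 1)
      - lam * W r ^ 2 / 2) := rfl
    have h3 : 0 ≤ W r ^ (p + 1) / (p + 1) := by positivity
    nlinarith [sq_nonneg (Y r)]
  obtain ⟨c, hc0, hc⟩ := exists_force_bounds hp hA hlam (lt_min hw₁pos hA) (min_le_right w₁ A)
    (le_max_right B A)
  have hcF : ∀ r, b ≤ r →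
      c / 2 * (W r - A) ^ 2 ≤ potential lam p (W r) - potential lam p A := fun r hr =>
    potential_quadratic_bound hp hc (min_le_right w₁ A) (le_max_right B A) (hWmem r hr)
  obtain ⟨h₀, hh₁, hh₂⟩ := exists_between (show a ^ 2 / 4 < (p - 1) * lam by linarith)
  obtain ⟨δ, hδ, hnear⟩ := exists_force_bound_near hp hA hlam hh₂
  obtain ⟨d, hd, hquad⟩ := exists_quadratic_form_bound (show a ^ 2 < 4 * h₀ by linarith)
  obtain ⟨r₁, hr₁, hE₁⟩ : ∃ r₁, b ≤ r₁ ∧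
      orbitEnergy lam p W Y r₁ - potential lam p A < c / 2 * δ ^ 2 := by
    have hev : ∀ᶠ w in nhds A, potential lam p w < potential lam p A + c * δ ^ 2 / 4 :=
      (continuous_potential hp).continuousAt.eventually_lt_const
        (by have : 0 < c * δ ^ 2 / 4 := by positivity
            linarith)
    obtain ⟨δ', hδ', hball⟩ := Metric.eventually_nhds_iff.1 hev
    obtain ⟨r, hr, hQ⟩ := exists_dist_sq_lt h hp ha hA hlam hb hc0
      (fun r hr => hc _ (hWmem r hr)) hcF (η := min (δ' ^ 2) (c * δ ^ 2 / 2)) (by positivity)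
    have h1 := hQ.trans_le (min_le_left _ _)
    have h2 := hQ.trans_le (min_le_right _ _)
    have h3 : |W r - A| < δ' := abs_lt_of_sq_lt_sq (by nlinarith [sq_nonneg (Y r)]) hδ'.le
    refine ⟨r, hr, ?_⟩
    have h4 := hball (y := W r) h3
    unfold orbitEnergy
    nlinarith [sq_nonneg (W r - A)]
  have hr₁0 : 0 < r₁ := hb.trans_le hr₁
  obtain ⟨r, hr, hlt⟩ := exists_lt_of_mul_deriv_le hr₁0 hd (fun r hr =>
    (h (r + 1)).hasDerivAt_orbitAngle hp ha hA hlam (b := b)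
      ⟨hb, by linarith⟩ (hin r (hr₁.trans hr))) (fun r hr => by
    have hbr := hr₁.trans hr
    have hX : |W r - A| < δ := by
      have h1 := hcF r hbr
      have h2 := hanti r₁ r hr₁ hr
      have h3 : potential lam p (W r) ≤ orbitEnergy lam p W Y r := by
        unfold orbitEnergy; nlinarith [sq_nonneg (Y r)]
      refine abs_lt_of_sq_lt_sq ?_ hδ.le
      have : c / 2 * (W r - A) ^ 2 < c / 2 * δ ^ 2 := by linarith
      exact lt_of_mul_lt_mul_left this (by positivity)
    have h1 := hnear (W r) hX
    have h2 := hquad (W r - A) (Y r)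
    have hQ := (h (r + 1)).dist_sq_pos hp ha hA hlam (hin' r hbr)
    have hr0 : r ≠ 0 := (hb.trans_le hbr).ne'
    have e : r * angSpeed a lam p A (fun r => r) (fun _ => 1) W Y r =
        -(Y r ^ 2 + a * (W r - A) * Y r + (W r - A) * (W r ^ p - lam * W r)) /
          ((W r - A) ^ 2 + Y r ^ 2) := by
      unfold angSpeed
      rw [mul_one]
      field_simp
    rw [e, div_le_iff₀ hQ]
    linarith) M
  exact ⟨r, hr₁.trans hr, hlt⟩

end IsDampedOrbit

lemma continuousOn_integral_of_continuousOn_prod {f : ℝ → ℝ → ℝ} {K : Set ℝ}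
    (hf : ContinuousOn (fun x : ℝ × ℝ => f x.1 x.2) (K ×ˢ Icc 0 1)) :
    ContinuousOn (fun e => ∫ x in (0:ℝ)..1, f e x) K := by
  rw [continuousOn_iff_continuous_domRestrict]
  have h1 : (K.domRestrict fun e => ∫ x in (0:ℝ)..1, f e x) =
      fun e : K => ∫ x in (0:ℝ)..1, f e (projIcc 0 1 zero_le_one x) := by
    funext e
    refine intervalIntegral.integral_congr fun x hx => ?_
    rw [uIcc_of_le zero_le_one] at hx
    simp only [projIcc_of_mem zero_le_one hx]
  rw [h1]
  apply intervalIntegral.continuous_parametric_intervalIntegral_of_continuous'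
  simp only [Function.uncurry_def]
  exact hf.comp_continuous (f := fun q : K × ℝ => ((q.1 : ℝ), (projIcc 0 1 zero_le_one q.2 : ℝ)))
    (by fun_prop) fun q => ⟨q.1.2, (projIcc 0 1 zero_le_one q.2).2⟩

namespace IsEmdenFamily

variable {m : ℕ} {p q a lam A : ℝ} {u z : ℝ → ℝ → ℝ}

/-- The angle of the orbit with parameter `e`, normalised at time `b`. -/
noncomputable def famAngle (p q a lam A : ℝ) (u z : ℝ → ℝ → ℝ) (b e r : ℝ) : ℝ :=
  orbitAngle a lam p A (sphRadius e) (fun r => cos (e * r)) (emdenW q u e) (emdenY q u z e) b r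

lemma continuousOn_famAngle (H : IsEmdenFamily m p q a lam A u z) {b : ℝ} {K : Set ℝ}
    {R : ℝ → ℝ} (hb : 0 < b)
    (horb : ∀ e ∈ K, IsDampedOrbit a lam p (sphRadius e) (fun r => cos (e * r)) (emdenW q u e)
      (emdenY q u z e) (R e))
    (hbA : ∀ e ∈ K, emdenW q u e b < A) (hR : ContinuousOn R K) (hbR : ∀ e ∈ K, b ≤ R e) :
    ContinuousOn (fun e => famAngle p q a lam A u z b e (R e)) K := by
  have hW := H.continuous_W
  have hY := H.continuous_Y
  have hp := H.one_lt_p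
  have hWp : Continuous fun x : ℝ × ℝ => emdenW q u x.1 x.2 ^ p :=
    hW.rpow_const fun _ => Or.inr (by linarith)
  have hS := continuous_sphRadius
  have hΘ : ContinuousOn (fun x : ℝ × ℝ => angSpeed a lam p A (sphRadius x.1)
      (fun r => cos (x.1 * r)) (emdenW q u x.1) (emdenY q u z x.1) x.2)
      {x | x.1 ∈ K ∧ x.2 ∈ Ioc 0 (R x.1)} := by
    unfold angSpeed
    refine ContinuousOn.div (by fun_prop) (by fun_prop) fun x hx => ?_
    exact (mul_pos ((horb x.1 hx.1).S_pos _ hx.2)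
      ((horb x.1 hx.1).dist_sq_pos hp H.a_pos H.A_pos H.A_rpow hx.2)).ne'
  have hangle : ∀ e, famAngle p q a lam A u z b e (R e) =
      arctan (emdenY q u z e b / (emdenW q u e b - A)) + (R e - b) *
      ∫ x in (0:ℝ)..1, angSpeed a lam p A (sphRadius e) (fun r => cos (e * r)) (emdenW q u e)
        (emdenY q u z e) (b + (R e - b) * x) := by
    intro e
    rw [famAngle, orbitAngle, ← smul_eq_mul, intervalIntegral.smul_integral_comp_add_mul]
    simp
  simp only [hangle]
  have hWb : Continuous fun e => emdenW q u e b := hW.comp (f := fun e => (e, b)) (by fun_prop)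
  have hYb : Continuous fun e => emdenY q u z e b := hY.comp (f := fun e => (e, b)) (by fun_prop)
  refine ContinuousOn.add ?_ ((hR.sub continuousOn_const).mul
    (continuousOn_integral_of_continuousOn_prod ?_))
  · exact continuous_arctan.comp_continuousOn (hYb.continuousOn.div (by fun_prop)
      fun e he => (sub_neg.2 (hbA e he)).ne)
  · refine hΘ.comp (f := fun x : ℝ × ℝ => (x.1, b + (R x.1 - b) * x.2)) ?_ ?_
    · have hR1 : ContinuousOn (fun x : ℝ × ℝ => R x.1) (K ×ˢ Icc 0 1) :=
        hR.comp continuousOn_fst fun x hx => hx.1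
      exact continuousOn_fst.prodMk (continuousOn_const.add
        ((hR1.sub continuousOn_const).mul continuousOn_snd))
    · rintro x ⟨hx1, hx2⟩
      have := hbR x.1 hx1
      exact ⟨hx1, by simp only; nlinarith [hx2.1], by simp only; nlinarith [hx2.2]⟩

/-- Infinitely many parameters produce solutions that are critical at the equator. -/
theorem exists_injective_critical (H : IsEmdenFamily m p q a lam A u z) :
    ∃ ε : ℕ → ℝ, Function.Injective ε ∧ ∀ k, 0 < ε k ∧ ε k ≤ 1 ∧ z (ε k) (π / (2 * ε k)) = 0 ∧
      ∀ r, 0 ≤ r → ε k * r ≤ π / 2 → 0 < u (ε k) r ∧ u (ε k) r < 2 := by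
  obtain ⟨e₀, he₀, he₀1, hbd⟩ := H.exists_uniform_bounds
  obtain ⟨B, hB, hBp⟩ := H.exists_bound
  have hp := H.one_lt_p
  have hq := H.q_pos
  have hA := H.A_pos
  have hpi := pi_pos
  have horb : ∀ e ∈ Icc 0 e₀, ∀ R, e * R ≤ π / 2 → IsDampedOrbit a lam p (sphRadius e)
      (fun r => cos (e * r)) (emdenW q u e) (emdenY q u z e) R := fun e he R hR =>
    H.isDampedOrbit he.1 (he.2.trans he₀1) hR fun r hr =>
      hbd e he r hr.1.le ((mul_le_mul_of_nonneg_left hr.2.le he.1).trans hR)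
  set b := min ((A / 4) ^ q⁻¹) (π / 4) with hbdef
  have hb : 0 < b := by positivity
  have hbq : b ^ q ≤ A / 4 := by
    have := rpow_le_rpow hb.le (min_le_left ((A / 4) ^ q⁻¹) (π / 4)) hq.le
    rwa [← rpow_mul (by positivity), inv_mul_cancel₀ hq.ne', rpow_one] at this
  have hb4 : b ≤ π / 4 := min_le_right _ _
  have hbA : ∀ e ∈ Icc 0 e₀, emdenW q u e b < A := by
    intro e he
    have h1 : e * b ≤ π / 2 := by nlinarith [he.1, he.2]
    have h2 := hbd e he b hb.le h1
    have h3 := sphRadius_pos he.1 hb (by linarith [pi_le_four])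
    have h4 := rpow_le_rpow h3.le (sphRadius_le e hb.le) hq.le
    have h5 : 0 < sphRadius e b ^ q := rpow_pos_of_pos h3 _
    unfold emdenW
    nlinarith
  have hbR : ∀ e ∈ Ioc 0 e₀, b ≤ π / (2 * e) := by
    intro e he
    rw [le_div_iff₀ (by linarith [he.1])]
    nlinarith [he.1, he.2]
  have heR : ∀ e ∈ Ioc 0 e₀, e * (π / (2 * e)) = π / 2 := fun e he => by
    have := he.1.ne'
    field_simp
  set F : ℝ → ℝ := fun e => famAngle p q a lam A u z b e (π / (2 * e)) with hF
  have hFc : ContinuousOn F (Ioc 0 e₀) := by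
    refine H.continuousOn_famAngle hb (fun e he => horb e (Ioc_subset_Icc_self he) _
      (heR e he).le) (fun e he => hbA e (Ioc_subset_Icc_self he)) ?_ hbR
    exact continuousOn_const.div (by fun_prop) fun e he => by have := he.1; positivity
  have hlimit : ∀ k : ℕ, ∃ e ∈ Ioc 0 e₀, F e ≤ -(k * π) := by
    intro k
    have h0m : (0:ℝ) ∈ Icc 0 e₀ := ⟨le_rfl, he₀.le⟩
    have hS0 : sphRadius 0 = fun r => r := funext sphRadius_zero_left
    have hC0 : (fun r : ℝ => cos (0 * r)) = fun _ => 1 := by funext r; simp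
    have h0 : ∀ R, IsDampedOrbit a lam p (fun r => r) (fun _ => 1) (emdenW q u 0)
        (emdenY q u z 0) R := fun R => by
      have := horb 0 h0m R (by simpa using (by positivity : 0 ≤ π / 2))
      rwa [hS0, hC0] at this
    obtain ⟨r, hr, hlt⟩ := IsDampedOrbit.exists_orbitAngle_lt h0 hp H.a_pos hA H.A_rpow H.discr
      hB hBp hb (-(k * π))
    have hr0 : 0 < r := hb.trans_le hr
    have hlt' : famAngle p q a lam A u z b 0 r < -(k * π) := by
      rwa [famAngle, hS0, hC0]
    set e₁ := min e₀ (π / (2 * r)) with he₁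
    have he₁0 : 0 < e₁ := by positivity
    have he₁r : ∀ e ∈ Icc 0 e₁, e * r ≤ π / 2 := fun e he => by
      have := he.2.trans (min_le_right _ _)
      rw [le_div_iff₀ (by positivity)] at this
      linarith
    have hc : ContinuousOn (fun e => famAngle p q a lam A u z b e r) (Icc 0 e₁) :=
      H.continuousOn_famAngle (R := fun _ => r) hb
        (fun e he => horb e ⟨he.1, he.2.trans (min_le_left _ _)⟩ _ (he₁r e he))
        (fun e he => hbA e ⟨he.1, he.2.trans (min_le_left _ _)⟩) continuousOn_const fun _ _ => hr
    have h1 := ((hc 0 ⟨le_rfl, he₁0.le⟩).mono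
      (Ioc_subset_Icc_self : Ioc 0 e₁ ⊆ Icc 0 e₁)).eventually_lt_const hlt'
    rw [nhdsWithin_Ioc_eq_nhdsGT he₁0] at h1
    obtain ⟨e, hlte, hem⟩ := (h1.and (Ioc_mem_nhdsGT he₁0)).exists
    have hem0 : e ∈ Ioc 0 e₀ := ⟨hem.1, hem.2.trans (min_le_left _ _)⟩
    refine ⟨e, hem0, ?_⟩
    refine (horb e (Ioc_subset_Icc_self hem0) _ (heR e hem0).le).angle_le_of_le hp H.a_pos hA
      H.A_rpow ⟨hb, hbR e hem0⟩ (hbA e (Ioc_subset_Icc_self hem0)) hr ⟨?_, le_rfl⟩ hlte.le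
    rw [le_div_iff₀ (by linarith [hem.1])]
    linarith [he₁r e (Ioc_subset_Icc_self hem)]
  obtain ⟨k₀, hk₀⟩ := exists_nat_gt (-F e₀ / π)
  have hk₀' : -(k₀ * π) < F e₀ := by
    rw [div_lt_iff₀ hpi] at hk₀; linarith
  have hIVT : ∀ j : ℕ, ∃ e ∈ Ioc 0 e₀, F e = -(((k₀ + j : ℕ) : ℝ) * π) := by
    intro j
    obtain ⟨e, he, hFe⟩ := hlimit (k₀ + j)
    have hsub : Icc e e₀ ⊆ Ioc 0 e₀ := fun x hx => ⟨he.1.trans_le hx.1, hx.2⟩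
    have hle : -(((k₀ + j : ℕ) : ℝ) * π) ≤ F e₀ := by
      push_cast
      have : 0 ≤ (j : ℝ) * π := by positivity
      linarith
    obtain ⟨x, hx, hxF⟩ := intermediate_value_Icc he.2 (hFc.mono hsub) ⟨hFe, hle⟩
    exact ⟨x, hsub hx, hxF⟩
  choose ε hε hεF using hIVT
  refine ⟨ε, fun i j hij => ?_, fun k => ⟨(hε k).1, (hε k).2.trans he₀1, ?_,
    hbd _ (Ioc_subset_Icc_self (hε k))⟩⟩
  · have h1 := hεF i
    rw [hij, hεF j, neg_inj, mul_left_inj' hpi.ne', Nat.cast_inj] at h1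
    omega
  · have hm := Ioc_subset_Icc_self (hε k)
    have hR := heR _ (hε k)
    have hbRk := hbR _ (hε k)
    have ho := horb _ hm _ hR.le
    have hY := ho.Y_eq_zero_of_angle hp H.a_pos hA H.A_rpow ⟨hb, hbRk⟩ (hbA _ hm)
      ⟨hbRk, le_rfl⟩ (hεF k)
    have hS := ho.S_pos _ ⟨hb.trans_le hbRk, le_rfl⟩
    rw [emdenY, hR, cos_pi_div_two, mul_zero, zero_mul, zero_add, mul_eq_zero,
      or_iff_right (rpow_pos_of_pos hS _).ne', mul_eq_zero, or_iff_right hS.ne'] at hY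
    exact hY

end IsEmdenFamily

/-- Below the Joseph–Lundgren exponent the linearisation at the equilibrium oscillates. -/
lemma discriminant_neg {N : ℕ} (hN : 4 ≤ N) {p q : ℝ} (hp : 1 < p)
    (hp2 : 11 ≤ N - 1 →
      p < 1 + 4 / (((N : ℝ) - 1) - 4 - 2 * √(((N : ℝ) - 1) - 1)))
    (hq : q = 2 / (p - 1)) (ha : 0 < (N : ℝ) - 3 - 2 * q) :
    ((N : ℝ) - 3 - 2 * q) ^ 2 < 4 * (2 * ((N : ℝ) - 3 - q)) := by
  have hp0 : 0 < p - 1 := by linarith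
  have hq0 : 0 < q := by rw [hq]; positivity
  have hN4 : (4:ℝ) ≤ N := by exact_mod_cast hN
  set s := √(((N : ℝ) - 1) - 1) with hs
  have hs2 : s ^ 2 = N - 2 := by rw [hs, sq_sqrt (by linarith)]; ring
  have hs0 : 0 ≤ s := sqrt_nonneg _
  have hs1 : 1 < s := by nlinarith
  have hlow : (N : ℝ) - 5 - 2 * s < 2 * q := by
    rcases le_or_gt 11 (N - 1) with h | h
    · have hN12 : (12:ℝ) ≤ N := by exact_mod_cast (by omega : 12 ≤ N)
      have h1 := hp2 h
      have hs3 : s ^ 2 - 3 - 2 * s = N - 5 - 2 * s := by rw [hs2]; ring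
      have hs4 : 3 < s := by nlinarith
      have hpos : 0 < (N : ℝ) - 5 - 2 * s := by rw [← hs3]; nlinarith
      have h2 : p - 1 < 4 / ((N : ℝ) - 5 - 2 * s) := by
        have e : (N : ℝ) - 1 - 4 - 2 * s = N - 5 - 2 * s := by ring
        rw [e] at h1; linarith
      rw [lt_div_iff₀ hpos] at h2
      have h3 : q * (p - 1) = 2 := by rw [hq]; field_simp
      nlinarith
    · have hN11 : (N:ℝ) ≤ 11 := by exact_mod_cast (by omega : N ≤ 11)
      have hs4 : s ≤ 3 := by nlinarith
      have : (N : ℝ) - 5 - 2 * s ≤ 0 := by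
        have : s ^ 2 - 3 - 2 * s = N - 5 - 2 * s := by rw [hs2]; ring
        rw [← this]; nlinarith
      linarith
  have h1 : (N : ℝ) - 3 - 2 * q < 2 + 2 * s := by linarith
  nlinarith

theorem stmt_18 (N : ℕ) (hN : 4 ≤ N) (p : ℝ)
    (hp1 : ((N : ℝ) + 1) / ((N : ℝ) - 3) < p)
    -- p < p_JL(N-1): for N-1 ≥ 11 this is an explicit bound, for N-1 ≤ 10 it is vacuous
    (hp2 : 11 ≤ N - 1 →
      p < 1 + 4 / (((N : ℝ) - 1) - 4 - 2 * Real.sqrt (((N : ℝ) - 1) - 1)))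
    (q μ : ℝ) (hq : q = 2 / (p - 1)) (hμ : μ = q * ((N : ℝ) - 2 - q)) :
    ∃ V : ℕ → ℝ → ℝ,
      (∀ i j : ℕ, i ≠ j → ∃ θ ∈ Icc (0:ℝ) (π / 2), V i θ ≠ V j θ) ∧
      ∀ k : ℕ,
        ContDiffOn ℝ 2 (V k) (Ioc 0 (π / 2)) ∧
        ContDiffOn ℝ 1 (V k) (Icc 0 (π / 2)) ∧
        (∀ θ ∈ Icc (0:ℝ) (π / 2), 0 < V k θ) ∧
        (∀ θ ∈ Ioo (0:ℝ) (π / 2),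
          deriv (deriv (V k)) θ + ((N : ℝ) - 2) * (Real.cos θ / Real.sin θ) * deriv (V k) θ
            - μ * V k θ + V k θ ^ p = 0) ∧
        derivWithin (V k) (Icc 0 (π / 2)) 0 = 0 ∧
        derivWithin (V k) (Icc 0 (π / 2)) (π / 2) = 0 := by
  have hN4 : (4:ℝ) ≤ N := by exact_mod_cast hN
  have hN3 : 0 < (N : ℝ) - 3 := by linarith
  have hpi := pi_pos
  have hpi4 := pi_le_four
  rw [div_lt_iff₀ hN3] at hp1
  have hp : 1 < p := by nlinarith
  have hp0 : 0 < p - 1 := by linarith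
  have hq0 : 0 < q := by rw [hq]; positivity
  have hqp : q * (p - 1) = 2 := by rw [hq]; field_simp
  have ha : 0 < (N : ℝ) - 3 - 2 * q := by
    have : 2 * q * (p - 1) < (N - 3) * (p - 1) := by nlinarith
    linarith [lt_of_mul_lt_mul_right this hp0.le]
  have hlam : 0 < q * ((N : ℝ) - 3 - q) := mul_pos hq0 (by linarith)
  have hm : ((N - 2 : ℕ) : ℝ) = N - 2 := by rw [Nat.cast_sub (by omega)]; norm_num
  have hμ0 : 0 ≤ μ := by rw [hμ]; exact mul_nonneg hq0.le (by linarith)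
  obtain ⟨u, z, hu, hz, hu0, hz0, hud, hzn, hzd⟩ := exists_regular_family (N - 2) hp hμ0
  have H : IsEmdenFamily (N - 2) p q ((N : ℝ) - 3 - 2 * q) (q * ((N : ℝ) - 3 - q))
      ((q * ((N : ℝ) - 3 - q)) ^ (p - 1)⁻¹) u z :=
    { one_lt_p := hp
      q_pos := hq0
      q_mul_p := by linarith
      a_pos := ha
      a_eq := by rw [hm]; ring
      lam_eq := by rw [hm]; ring
      A_pos := by positivity
      A_rpow := by rw [← rpow_mul hlam.le, inv_mul_cancel₀ hp0.ne', rpow_one]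
      discr := by
        have := discriminant_neg hN hp hp2 hq ha
        have e : (p - 1) * (q * ((N : ℝ) - 3 - q)) = 2 * ((N : ℝ) - 3 - q) := by
          rw [← hqp]; ring
        rwa [e]
      cont_u := hu
      cont_z := hz
      u_zero := hu0
      z_zero := hz0
      deriv_u := hud
      z_nonpos := hzn
      deriv_z := fun e r h1 h2 h3 h4 => by
        have := hzd e r h1 h2 h3 h4
        rwa [hμ, ← hm] at this }
  obtain ⟨ε, hinj, hε⟩ := H.exists_injective_critical
  have hue : ∀ e, Continuous (u e) := fun e => hu.comp (f := fun r => (e, r)) (by fun_prop)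
  have hze : ∀ e, Continuous (z e) := fun e => hz.comp (f := fun r => (e, r)) (by fun_prop)
  set V : ℕ → ℝ → ℝ := fun k θ => ε k ^ (-q) * u (ε k) (θ / ε k) with hV
  have hVd : ∀ k θ, HasDerivAt (V k) (ε k ^ (-q) * (z (ε k) (θ / ε k) / ε k)) θ := by
    intro k θ
    refine (((hud (ε k) (θ / ε k)).comp θ ((hasDerivAt_id θ).div_const (ε k))).const_mul
      (ε k ^ (-q))).congr_deriv ?_
    ring
  have hVderiv : ∀ k, deriv (V k) = fun θ => ε k ^ (-q) * (z (ε k) (θ / ε k) / ε k) :=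
    fun k => funext fun θ => (hVd k θ).deriv
  have hVc1 : ∀ k, ContDiff ℝ 1 (V k) := by
    intro k
    rw [contDiff_one_iff_deriv, hVderiv]
    refine ⟨fun θ => (hVd k θ).differentiableAt, ?_⟩
    have := hze (ε k)
    fun_prop
  have hVdd : ∀ k, ∀ θ ∈ Ioo (0:ℝ) 2, HasDerivAt (deriv (V k))
      (ε k ^ (-q) * ((ε k ^ 2 * μ * u (ε k) (θ / ε k) - truncPow p (u (ε k) (θ / ε k))
        - (N - 2) * (cos θ / (sin θ / ε k)) * z (ε k) (θ / ε k)) / ε k ^ 2)) θ := by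
    intro k θ hθ
    obtain ⟨h0, h1, -, -⟩ := hε k
    have hmul : ε k * (θ / ε k) = θ := by field_simp
    have hS : sphRadius (ε k) (θ / ε k) = sin θ / ε k := by
      rw [eq_div_iff h0.ne', mul_comm, mul_sphRadius, hmul]
    have h := hzd (ε k) (θ / ε k) h0.le h1 (div_pos hθ.1 h0) (by rw [hmul]; exact hθ.2)
    rw [hmul, hS, hm] at h
    rw [hVderiv]
    refine (((h.comp θ ((hasDerivAt_id θ).div_const (ε k))).div_const (ε k)).const_mul
      (ε k ^ (-q))).congr_deriv ?_
    field_simp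
  refine ⟨V, fun i j hij => ⟨0, ⟨le_rfl, by positivity⟩, fun h => hij (hinj ?_)⟩, fun k => ?_⟩
  · simp only [hV, zero_div, hu0, mul_one] at h
    exact (rpow_left_inj (hε i).1.le (hε j).1.le (neg_ne_zero.2 hq0.ne')).1 h
  obtain ⟨h0, h1, hzR, hbd⟩ := hε k
  have hmul : ∀ θ, ε k * (θ / ε k) = θ := fun θ => by field_simp
  have hub : ∀ θ ∈ Icc (0:ℝ) (π / 2), 0 < u (ε k) (θ / ε k) ∧ u (ε k) (θ / ε k) < 2 :=
    fun θ hθ => hbd _ (div_nonneg hθ.1 h0.le) (by rw [hmul]; exact hθ.2)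
  have hud2 : UniqueDiffOn ℝ (Icc 0 (π / 2)) := uniqueDiffOn_Icc (by positivity)
  refine ⟨?_, (hVc1 k).contDiffOn, fun θ hθ => mul_pos (rpow_pos_of_pos h0 _) (hub θ hθ).1,
    fun θ hθ => ?_, ?_, ?_⟩
  · have : ContDiffOn ℝ 2 (V k) (Ioo 0 2) := by
      rw [show (2 : WithTop ℕ∞) = 1 + 1 by norm_num, contDiffOn_succ_iff_deriv_of_isOpen isOpen_Ioo]
      refine ⟨fun θ _ => (hVd k θ).differentiableAt.differentiableWithinAt, by simp, ?_⟩
      rw [show (1 : WithTop ℕ∞) = 0 + 1 by norm_num, contDiffOn_succ_iff_deriv_of_isOpen isOpen_Ioo]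
      refine ⟨fun θ hθ => (hVdd k θ hθ).differentiableAt.differentiableWithinAt, by simp, ?_⟩
      rw [contDiffOn_zero]
      refine ContinuousOn.congr ?_ fun θ hθ => (hVdd k θ hθ).deriv
      have c1 : Continuous fun θ => u (ε k) (θ / ε k) := (hue (ε k)).comp (by fun_prop)
      have c2 : Continuous fun θ => z (ε k) (θ / ε k) := (hze (ε k)).comp (by fun_prop)
      have c3 : Continuous fun θ => truncPow p (u (ε k) (θ / ε k)) :=
        (continuous_truncPow hp).comp c1
      have c4 : ContinuousOn (fun θ => cos θ / (sin θ / ε k)) (Ioo 0 2) := by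
        refine ContinuousOn.div (by fun_prop) (by fun_prop) fun θ hθ => ?_
        exact (div_pos (sin_pos_of_mem_Ioo ⟨hθ.1, by linarith [hθ.2, pi_gt_three]⟩) h0).ne'
      fun_prop
    exact this.mono fun θ hθ => ⟨hθ.1, by linarith [hθ.2, pi_lt_d2]⟩
  · have hθI := Ioo_subset_Icc_self hθ
    rw [(hVdd k θ ⟨hθ.1, by linarith [hθ.2]⟩).deriv, (hVd k θ).deriv,
      truncPow_eq (hub θ hθI).1.le (hub θ hθI).2.le]
    have hs : sin θ ≠ 0 := (sin_pos_of_mem_Ioo ⟨hθ.1, by linarith [hθ.2]⟩).ne'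
    have hVp : V k θ ^ p = ε k ^ (-q) / ε k ^ 2 * u (ε k) (θ / ε k) ^ p := by
      simp only [hV]
      rw [mul_rpow (by positivity) (hub θ hθI).1.le, ← rpow_mul h0.le,
        show -q * p = -q - 2 by linarith, rpow_sub h0, rpow_two]
    rw [hVp]
    simp only [hV]
    field_simp
    ring
  · rw [((hVd k 0).hasDerivWithinAt).derivWithin (hud2 0 ⟨le_rfl, by positivity⟩)]
    simp [hz0]
  · rw [((hVd k (π / 2)).hasDerivWithinAt).derivWithin (hud2 _ ⟨by positivity, le_rfl⟩)]
    rw [div_div, hzR]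
    simp
end
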